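/- For every integer k ≥ 2, the refutation system Res(k) does not have the weak feasible disjunction property; that is, there is no polynomial p such that for every pair of CNFs A and B sharing no propositional variables, whenever the CNF A ∧ B has a Res(k) refutation of length t, then A or B has a Res(k) refutation of length at most p(t). -/

import Mathlib

open Classical Finset

structure Lit (V : Type) where
  var : V
  pos : Bool
deriving DecidableEq

abbrev Clause (V : Type) := Finset (Lit V)
abbrev PTerm (V : Type) := Finset (Lit V)
abbrev Cnf (V : Type) := Finset (Clause V)
abbrev Dnf (V : Type) := Finset (PTerm V)

variable {V : Type} [DecidableEq V]

def Lit.neg (l : Lit V) : Lit V := ⟨l.var, !l.pos⟩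

/-- A clause viewed as a 1-DNF. -/
def clauseToDnf (C : Clause V) : Dnf V := C.image (fun l => {l})

/-- A `k`-DNF: every term has at most `k` literals. -/
def IsKDnf (k : ℕ) (G : Dnf V) : Prop := ∀ q ∈ G, q.card ≤ k

/-- The inference rules of Res(k): axiom, weakening, ∧-introduction and cut. -/
inductive ResKInf (k : ℕ) : List (Dnf V) → Dnf V → Prop
  | ax (x : V) :
      ResKInf k [] {{(⟨x, true⟩ : Lit V)}, {(⟨x, false⟩ : Lit V)}}
  | weaken (A B : Dnf V) : ResKInf k [A] (A ∪ B)
  | andIntro (A B : Dnf V) (l : Lit V) (q : PTerm V) (hq : q.card + 1 ≤ k) :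
      ResKInf k [A ∪ {({l} : PTerm V)}, B ∪ {q}] (A ∪ B ∪ {insert l q})
  | cut (A B : Dnf V) (q : PTerm V) :
      ResKInf k [A ∪ {q}, B ∪ q.image (fun l => ({l.neg} : PTerm V))] (A ∪ B)

/-- A Res(k) refutation of the CNF `F`: a sequence of k-DNFs, each a clause of `F`
or inferred from earlier lines, ending with the empty clause. -/
def IsResKRefutation (k : ℕ) (F : Set (Clause V)) (P : List (Dnf V)) : Prop :=
  P ≠ [] ∧ P.getLast? = some (∅ : Dnf V) ∧ (∀ G ∈ P, IsKDnf k G) ∧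
  ∀ i : Fin P.length,
    (∃ C ∈ F, P.get i = clauseToDnf C) ∨
    ∃ prems : List (Dnf V), ResKInf k prems (P.get i) ∧
      ∀ Q ∈ prems, ∃ j : Fin P.length, (j : ℕ) < (i : ℕ) ∧ P.get j = Q

/-- The number of symbols in a DNF. -/
def dnfSize (G : Dnf V) : ℕ := ∑ q ∈ G, (q.card + 1)

/-- The size (number of symbols) of a Res(k) refutation. -/
def proofSize (P : List (Dnf V)) : ℕ := (P.map dnfSize).sum

/-- The size (number of symbols) of a CNF. -/
def cnfSize (F : Cnf V) : ℕ := ∑ C ∈ F, (C.card + 1)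

/-- The set of propositional variables occurring in a CNF. -/
def cnfVars (F : Cnf V) : Finset V := F.sup (fun C => C.image Lit.var)

def SatClauseA (a : V → Bool) (C : Clause V) : Prop := ∃ l ∈ C, a l.var = l.pos

/-- Unsatisfiability of a CNF. -/
def Unsat (F : Set (Clause V)) : Prop := ¬ ∃ a : V → Bool, ∀ C ∈ F, SatClauseA a C

def litSatP (π : V → Option Bool) (l : Lit V) : Prop := π l.var = some l.pos
def litFalsP (π : V → Option Bool) (l : Lit V) : Prop := π l.var = some (!l.pos)

/-- A partial assignment satisfies a term if it satisfies all its literals. -/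
def satPTerm (π : V → Option Bool) (q : PTerm V) : Prop := ∀ l ∈ q, litSatP π l
/-- A partial assignment falsifies a term if it falsifies some literal of it. -/
def falsPTerm (π : V → Option Bool) (q : PTerm V) : Prop := ∃ l ∈ q, litFalsP π l

/-- The restriction of a DNF by a partial assignment: falsified terms are removed,
and satisfied literals are removed from the remaining terms. -/
noncomputable def restrictDnf (G : Dnf V) (π : V → Option Bool) : Dnf V :=
  (G.filter (fun q => ¬ falsPTerm π q)).image (fun q => q.filter (fun l => ¬ litSatP π l))

def clauseSatP (π : V → Option Bool) (C : Clause V) : Prop := ∃ l ∈ C, litSatP π l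

/-- The restriction of a clause: falsified literals are removed. -/
noncomputable def restrictClause (C : Clause V) (π : V → Option Bool) : Clause V :=
  C.filter (fun l => ¬ litFalsP π l)

/-- The restriction of a CNF by a partial assignment: satisfied clauses are removed,
falsified literals are removed from the remaining clauses. -/
def restrictCnfSet (F : Set (Clause V)) (π : V → Option Bool) : Set (Clause V) :=
  {E | ∃ C ∈ F, ¬ clauseSatP π C ∧ E = restrictClause C π}

/-- A resolution refutation of the CNF `F` (weakening is built into the rules). -/
def IsResRefutation (F : Set (Clause V)) (P : List (Clause V)) : Prop :=
  P ≠ [] ∧ P.getLast? = some (∅ : Clause V) ∧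
  ∀ i : Fin P.length,
    (∃ C ∈ F, C ⊆ P.get i) ∨
    ∃ jv jw : Fin P.length, (jv : ℕ) < (i : ℕ) ∧ (jw : ℕ) < (i : ℕ) ∧ ∃ x : V,
      (⟨x, true⟩ : Lit V) ∈ P.get jv ∧ (⟨x, false⟩ : Lit V) ∈ P.get jw ∧
      ((P.get jv).erase ⟨x, true⟩ ∪ (P.get jw).erase ⟨x, false⟩) ⊆ P.get i


set_option linter.unusedSectionVars false

namespace ResKWeak

section Cube

/-- If each of finitely many subcubes of codimension at most `c` has its own coordinates,
a fraction of at most `(1 - 2⁻ᶜ)ᵐ` of all points avoids all `m` of them. -/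
theorem card_avoid_subcubes {X ι : Type} [Fintype X] (c : ℕ) (S : ι → Finset X)
    (p : ι → X → Bool) (s : Finset ι)
    (hc : ∀ i ∈ s, (S i).card ≤ c)
    (hdisj : ∀ i ∈ s, ∀ j ∈ s, i ≠ j → Disjoint (S i) (S j)) :
    (univ.filter fun ρ : X → Bool => ∀ i ∈ s, ∃ x ∈ S i, ρ x ≠ p i x).card * (2 ^ c) ^ s.card ≤
      (2 ^ c - 1) ^ s.card * 2 ^ Fintype.card X := by
  induction s using Finset.induction_on with
  | empty => simp
  | insert i s hi ih =>
    have ih := ih (fun j hj => hc j (mem_insert_of_mem hj))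
      (fun j hj l hl => hdisj j (mem_insert_of_mem hj) l (mem_insert_of_mem hl))
    set N := univ.filter fun ρ : X → Bool => ∀ j ∈ s, ∃ x ∈ S j, ρ x ≠ p j x with hN
    set B := N.filter fun ρ => ∀ x ∈ S i, ρ x = p i x with hB
    have hN' : (univ.filter fun ρ : X → Bool => ∀ j ∈ insert i s, ∃ x ∈ S j, ρ x ≠ p j x) =
        N \ B := by
      ext ρ
      simp only [hN, hB, mem_filter, mem_univ, true_and, mem_sdiff, mem_insert, forall_eq_or_imp]
      constructor
      · rintro ⟨⟨x, hx, hne⟩, h2⟩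
        exact ⟨h2, fun h => hne (h.2 x hx)⟩
      · rintro ⟨h1, h2⟩
        refine ⟨?_, h1⟩
        by_contra hcon
        push Not at hcon
        exact h2 ⟨h1, hcon⟩
    have hBN : B ⊆ N := filter_subset _ _
    have hkey : N.card ≤ B.card * 2 ^ c := by
      have h1 : N.card ≤ (B ×ˢ (univ : Finset (S i → Bool))).card := by
        refine Finset.card_le_card_of_injOn
          (fun ρ => ((S i).piecewise (p i) ρ, fun x : S i => ρ x)) ?_ ?_
        · intro ρ hρ
          simp only [coe_product, Set.mem_prod, mem_coe, mem_univ, and_true]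
          simp only [hB, mem_filter]
          refine ⟨?_, fun x hx => by simp [hx]⟩
          simp only [hN, mem_coe, mem_filter, mem_univ, true_and] at hρ ⊢
          intro j hj
          obtain ⟨x, hx, hne⟩ := hρ j hj
          have hxi : x ∉ S i := by
            have hij : i ≠ j := fun h => hi (h ▸ hj)
            exact fun hxi => Finset.disjoint_left.1
              (hdisj i (mem_insert_self _ _) j (mem_insert_of_mem hj) hij) hxi hx
          exact ⟨x, hx, by simpa [hxi] using hne⟩
        · intro ρ _ ρ' _ heq
          simp only [Prod.mk.injEq] at heq
          funext x
          by_cases hx : x ∈ S i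
          · exact congrFun heq.2 ⟨x, hx⟩
          · simpa [hx] using congrFun heq.1 x
      have h2 : (B ×ˢ (univ : Finset (S i → Bool))).card = B.card * 2 ^ (S i).card := by
        simp [card_product]
      calc N.card ≤ B.card * 2 ^ (S i).card := h2 ▸ h1
        _ ≤ B.card * 2 ^ c :=
          Nat.mul_le_mul_left _ (Nat.pow_le_pow_right (by norm_num) (hc i (mem_insert_self _ _)))
    rw [hN', card_insert_of_notMem hi, card_sdiff_of_subset hBN, pow_succ, pow_succ]
    have hstep : (N.card - B.card) * 2 ^ c ≤ N.card * (2 ^ c - 1) := by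
      rw [Nat.sub_mul, Nat.mul_sub, mul_one]
      omega
    calc (N.card - B.card) * ((2 ^ c) ^ s.card * 2 ^ c)
        = ((N.card - B.card) * 2 ^ c) * (2 ^ c) ^ s.card := by ring
      _ ≤ (N.card * (2 ^ c - 1)) * (2 ^ c) ^ s.card := Nat.mul_le_mul_right _ hstep
      _ = (N.card * (2 ^ c) ^ s.card) * (2 ^ c - 1) := by ring
      _ ≤ ((2 ^ c - 1) ^ s.card * 2 ^ Fintype.card X) * (2 ^ c - 1) :=
          Nat.mul_le_mul_right _ ih
      _ = _ := by ring

theorem two_mul_pow_self_le (a : ℕ) : 2 * a ^ (a + 1) ≤ (a + 1) ^ (a + 1) := by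
  have h : ∀ m : ℕ, a ^ (m + 1) + (m + 1) * a ^ m ≤ (a + 1) ^ (m + 1) := by
    intro m
    induction m with
    | zero => simp
    | succ m ih =>
      calc a ^ (m + 2) + (m + 2) * a ^ (m + 1)
          ≤ (a ^ (m + 1) + (m + 1) * a ^ m) * (a + 1) := by ring_nf; nlinarith [Nat.zero_le (a^m * m), Nat.zero_le (a^m)]
        _ ≤ (a + 1) ^ (m + 1) * (a + 1) := Nat.mul_le_mul_right _ ih
        _ = (a + 1) ^ (m + 2) := by ring
  have := h a
  calc 2 * a ^ (a + 1) ≤ a ^ (a + 1) + (a + 1) * a ^ a := by ring_nf; nlinarith [Nat.zero_le (a^a)]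
    _ ≤ _ := this

theorem card_avoid_subcubes_le {X ι : Type} [Fintype X] (c e : ℕ) (S : ι → Finset X)
    (p : ι → X → Bool) (s : Finset ι)
    (hc : ∀ i ∈ s, (S i).card ≤ c)
    (hdisj : ∀ i ∈ s, ∀ j ∈ s, i ≠ j → Disjoint (S i) (S j)) (hs : 2 ^ c * e ≤ s.card) :
    (univ.filter fun ρ : X → Bool => ∀ i ∈ s, ∃ x ∈ S i, ρ x ≠ p i x).card * 2 ^ e ≤
      2 ^ Fintype.card X := by
  obtain ⟨t, hts, htc⟩ := Finset.exists_subset_card_eq hs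
  have h := card_avoid_subcubes c S p t (fun i hi => hc i (hts hi))
    (fun i hi j hj => hdisj i (hts hi) j (hts hj))
  set A := univ.filter fun ρ : X → Bool => ∀ i ∈ t, ∃ x ∈ S i, ρ x ≠ p i x
  have hA : (univ.filter fun ρ : X → Bool => ∀ i ∈ s, ∃ x ∈ S i, ρ x ≠ p i x).card ≤ A.card := by
    refine card_le_card fun ρ hρ => ?_
    simp only [mem_filter, mem_univ, true_and, A] at hρ ⊢
    exact fun i hi => hρ i (hts hi)
  refine (Nat.mul_le_mul_right _ hA).trans ?_
  obtain ⟨a, ha⟩ : ∃ a, 2 ^ c = a + 1 := ⟨2 ^ c - 1, by have := Nat.one_le_two_pow (n := c); omega⟩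
  rw [htc, ha, Nat.add_sub_cancel] at h
  have h2 : 2 ^ e * a ^ ((a + 1) * e) ≤ (a + 1) ^ ((a + 1) * e) := by
    rw [pow_mul, pow_mul, ← mul_pow]
    exact Nat.pow_le_pow_left (two_mul_pow_self_le a) e
  have hpos : 0 < (a + 1) ^ ((a + 1) * e) := by positivity
  refine Nat.le_of_mul_le_mul_right ?_ hpos
  calc A.card * 2 ^ e * (a + 1) ^ ((a + 1) * e)
      = (A.card * (a + 1) ^ ((a + 1) * e)) * 2 ^ e := by ring
    _ ≤ (a ^ ((a + 1) * e) * 2 ^ Fintype.card X) * 2 ^ e := Nat.mul_le_mul_right _ h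
    _ = (2 ^ e * a ^ ((a + 1) * e)) * 2 ^ Fintype.card X := by ring
    _ ≤ (a + 1) ^ ((a + 1) * e) * 2 ^ Fintype.card X := Nat.mul_le_mul_right _ h2
    _ = _ := by ring

end Cube

end ResKWeak

namespace ResKWeak

section Semantics

/-- A term that contains no complementary literals. -/
def Consistent (q : PTerm V) : Prop := ∀ l ∈ q, l.neg ∉ q

/-- A partial assignment falsifies every consistent term of a DNF. -/
def FalsDnf (π : V → Option Bool) (G : Dnf V) : Prop := ∀ q ∈ G, Consistent q → falsPTerm π q

def SatDnf (π : V → Option Bool) (G : Dnf V) : Prop := ∃ q ∈ G, satPTerm π q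

def EvalDnf (a : V → Bool) (G : Dnf V) : Prop := ∃ q ∈ G, ∀ l ∈ q, a l.var = l.pos

theorem resKInf_sound {k : ℕ} {prems : List (Dnf V)} {G : Dnf V} (h : ResKInf k prems G)
    (a : V → Bool) (ha : ∀ Q ∈ prems, EvalDnf a Q) : EvalDnf a G := by
  cases h with
  | ax x =>
    cases hx : a x
    · exact ⟨{⟨x, false⟩}, by simp, by simp [hx]⟩
    · exact ⟨{⟨x, true⟩}, by simp, by simp [hx]⟩
  | weaken A B =>
    obtain ⟨q, hq, h⟩ := ha A (by simp)
    exact ⟨q, mem_union_left _ hq, h⟩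
  | andIntro A B l q hq =>
    obtain ⟨q₁, hq₁, h₁⟩ := ha _ (List.mem_cons_self)
    obtain ⟨q₂, hq₂, h₂⟩ := ha _ (List.mem_cons_of_mem _ List.mem_cons_self)
    rcases mem_union.1 hq₁ with hA | hA
    · exact ⟨q₁, by simp [hA], h₁⟩
    rcases mem_union.1 hq₂ with hB | hB
    · exact ⟨q₂, by simp [hB], h₂⟩
    rw [mem_singleton] at hA hB
    subst hA hB
    refine ⟨insert l q₂, by simp, ?_⟩
    intro l' hl'
    rcases mem_insert.1 hl' with rfl | hl'
    · exact h₁ _ (by simp)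
    · exact h₂ _ hl'
  | cut A B q =>
    obtain ⟨q₁, hq₁, h₁⟩ := ha _ (List.mem_cons_self)
    obtain ⟨q₂, hq₂, h₂⟩ := ha _ (List.mem_cons_of_mem _ List.mem_cons_self)
    rcases mem_union.1 hq₁ with hA | hA
    · exact ⟨q₁, by simp [hA], h₁⟩
    rcases mem_union.1 hq₂ with hB | hB
    · exact ⟨q₂, by simp [hB], h₂⟩
    rw [mem_singleton] at hA
    obtain ⟨l, hl, rfl⟩ := mem_image.1 hB
    subst hA
    have e₁ := h₁ l hl
    have e₂ := h₂ l.neg (by simp)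
    simp [Lit.neg, e₁] at e₂

theorem resKInf_length_le {k : ℕ} {prems : List (Dnf V)} {G : Dnf V} (h : ResKInf k prems G) :
    prems.length ≤ 2 := by
  cases h <;> simp

theorem not_evalDnf_of_falsDnf {π : V → Option Bool} {G : Dnf V} (h : FalsDnf π G) {a : V → Bool}
    (ha : ∀ v b, π v = some b → a v = b) : ¬ EvalDnf a G := by
  rintro ⟨q, hq, hsat⟩
  have hcons : Consistent q := by
    intro l hl hneg
    have h₁ := hsat l hl
    have h₂ := hsat _ hneg
    simp [Lit.neg, h₁] at h₂
  obtain ⟨l, hl, hf⟩ := h q hq hcons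
  have := ha _ _ hf
  simp [hsat l hl] at this

theorem evalDnf_of_satDnf {π : V → Option Bool} {G : Dnf V} (h : SatDnf π G) {a : V → Bool}
    (ha : ∀ v b, π v = some b → a v = b) : EvalDnf a G := by
  obtain ⟨q, hq, hsat⟩ := h
  exact ⟨q, hq, fun l hl => ha _ _ (hsat l hl)⟩

theorem SatDnf.mono {π π' : V → Option Bool} (hπ : ∀ v b, π v = some b → π' v = some b)
    {G : Dnf V} (h : SatDnf π G) : SatDnf π' G := by
  obtain ⟨q, hq, hsat⟩ := h
  exact ⟨q, hq, fun l hl => hπ _ _ (hsat l hl)⟩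

theorem FalsDnf.mono {π π' : V → Option Bool} (hπ : ∀ v b, π v = some b → π' v = some b)
    {G : Dnf V} (h : FalsDnf π G) : FalsDnf π' G := by
  intro q hq hc
  obtain ⟨l, hl, hf⟩ := h q hq hc
  exact ⟨l, hl, hπ _ _ hf⟩

end Semantics

section Relativization

/-- The variables of a relativized formula: each block `w` has `k` selector bits, and for each
value of the selector its own copy of the data bits of the block. -/
abbrev RelVar (k : ℕ) (W I : Type) : Type := W × (Fin k ⊕ (Fin k → Bool) × I)

/-- A partial choice of the data of the selected copies. -/
abbrev Position (W I : Type) : Type := W → Option (I → Bool)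

variable {k : ℕ} {W I : Type} [Fintype W] [DecidableEq W] [Fintype I] [DecidableEq I]

def selOf (ρ : RelVar k W I → Bool) (w : W) : Fin k → Bool := fun i => ρ (w, Sum.inl i)

/-- The partial assignment given by the selectors and unselected copies of `ρ` and by the
position `α` for selected copies. -/
noncomputable def view (ρ : RelVar k W I → Bool) (α : Position W I) : RelVar k W I → Option Bool
  | (w, Sum.inl i) => some (ρ (w, Sum.inl i))
  | (w, Sum.inr (σ, i)) =>
    if σ = selOf ρ w then (α w).map (fun d => d i) else some (ρ (w, Sum.inr (σ, i)))

def dom (α : Position W I) : Finset W := univ.filter fun w => (α w).isSome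

/-- `β` extends `α`. -/
def Extends (α β : Position W I) : Prop := ∀ w d, α w = some d → β w = some d

noncomputable def Position.restrict (α : Position W I) (H : Finset W) : Position W I :=
  fun w => if w ∈ H then α w else none

theorem mem_dom {α : Position W I} {w : W} : w ∈ dom α ↔ α w ≠ none := by
  simp [dom, Option.isSome_iff_ne_none]

theorem Extends.trans {α β γ : Position W I} (h₁ : Extends α β) (h₂ : Extends β γ) :
    Extends α γ := fun w d h => h₂ w d (h₁ w d h)

theorem Extends.view {α β : Position W I} (h : Extends α β) (ρ : RelVar k W I → Bool)
    (v : RelVar k W I) (b : Bool) (hv : view ρ α v = some b) : view ρ β v = some b := by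
  obtain ⟨w, i | ⟨σ, i⟩⟩ := v
  · exact hv
  · simp only [ResKWeak.view] at hv ⊢
    split_ifs at hv ⊢
    · obtain ⟨d, hd, hdi⟩ := Option.map_eq_some_iff.1 hv
      exact Option.map_eq_some_iff.2 ⟨d, h w d hd, hdi⟩
    · exact hv

theorem restrict_extends (α : Position W I) (H : Finset W) : Extends (α.restrict H) α := by
  intro w d h
  simp only [Position.restrict] at h
  split_ifs at h
  exact h

theorem Extends.restrict {α β : Position W I} (h : Extends α β) {H : Finset W}
    (hH : dom α ⊆ H) : Extends α (β.restrict H) := by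
  intro w d hw
  have : w ∈ H := hH (mem_dom.2 (by simp [hw]))
  simp [Position.restrict, this, h w d hw]

theorem dom_restrict_subset (α : Position W I) (H : Finset W) : dom (α.restrict H) ⊆ H := by
  intro w hw
  by_contra h
  exact mem_dom.1 hw (by simp [Position.restrict, h])

theorem Extends.dom_subset {α β : Position W I} (h : Extends α β) : dom α ⊆ dom β := by
  intro w hw
  obtain ⟨d, hd⟩ := Option.ne_none_iff_exists'.1 (mem_dom.1 hw)
  exact mem_dom.2 (by simp [h w d hd])

/-- A family of positions in which an adversary can answer `M` questions about blocks. -/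
structure Strategy (P : Set (Position W I)) (M : ℕ) : Prop where
  empty : (fun _ => none) ∈ P
  mono : ∀ α β, Extends α β → β ∈ P → α ∈ P
  ext : ∀ α ∈ P, (dom α).card < M → ∀ w, ∃ β ∈ P, Extends α β ∧ w ∈ dom β ∧
    dom β ⊆ insert w (dom α)

theorem Strategy.exists_extends {P : Set (Position W I)} {M : ℕ} (hP : Strategy P M)
    (H : Finset W) : ∀ α ∈ P, (dom α).card + H.card ≤ M →
      ∃ β ∈ P, Extends α β ∧ H ⊆ dom β ∧ dom β ⊆ H ∪ dom α := by
  induction H using Finset.induction_on with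
  | empty => exact fun α hα _ => ⟨α, hα, fun _ _ h => h, by simp, by simp⟩
  | insert w H hw ih =>
    intro α hα hcard
    rw [card_insert_of_notMem hw] at hcard
    obtain ⟨β, hβ, hαβ, hHβ, hβH⟩ := ih α hα (by omega)
    have hlt : (dom β).card < M := by
      have h₁ := card_le_card hβH
      have h₂ := card_union_le H (dom α)
      omega
    obtain ⟨γ, hγ, hβγ, hwγ, hγβ⟩ := hP.ext β hβ hlt w
    refine ⟨γ, hγ, hαβ.trans hβγ, ?_, ?_⟩
    · intro x hx
      rcases mem_insert.1 hx with rfl | hx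
      · exact hwγ
      · exact hβγ.dom_subset (hHβ hx)
    · intro x hx
      rcases mem_insert.1 (hγβ hx) with rfl | hx
      · simp
      · have := hβH hx
        simp only [mem_union, mem_insert] at this ⊢
        tauto

/-- Under `ρ`, at most `h` questions about blocks suffice to evaluate `G`. -/
def Decided (P : Set (Position W I)) (M : ℕ) (ρ : RelVar k W I → Bool) (h : ℕ)
    (G : Dnf (RelVar k W I)) : Prop :=
  ∀ α ∈ P, (dom α).card + h ≤ M → ∃ α' ∈ P, Extends α α' ∧ (dom α').card ≤ (dom α).card + h ∧
    ∃ β, Extends β α' ∧ (dom β).card ≤ h ∧ (SatDnf (view ρ β) G ∨ FalsDnf (view ρ β) G)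

/-- The blocks mentioned in a term. -/
def blocks (q : PTerm (RelVar k W I)) : Finset W := q.image fun l => l.var.1

/-- A selector value compatible with the literals of `q` whose copy is not mentioned in `q`. -/
theorem exists_selector {q : PTerm (RelVar k W I)} (hq : q.card ≤ k) (w : W) :
    ∃ σ : Fin k → Bool,
      (∀ i b, (⟨(w, Sum.inl i), b⟩ : Lit (RelVar k W I)) ∈ q →
        σ i = decide ((⟨(w, Sum.inl i), true⟩ : Lit (RelVar k W I)) ∈ q)) ∧
      ∀ τ i b, (⟨(w, Sum.inr (τ, i)), b⟩ : Lit (RelVar k W I)) ∈ q → τ ≠ σ := by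
  set X : Finset (Fin k) := univ.filter fun i =>
    ∃ b, (⟨(w, Sum.inl i), b⟩ : Lit (RelVar k W I)) ∈ q with hX
  set Y : Finset (Fin k → Bool) := univ.filter fun τ =>
    ∃ i b, (⟨(w, Sum.inr (τ, i)), b⟩ : Lit (RelVar k W I)) ∈ q with hY
  have hcard : X.card + Y.card ≤ q.card := by
    have h₁ : X.card ≤ (q.filter fun l => ∃ i, l.var.2 = Sum.inl i).card := by
      refine Finset.card_le_card_of_forall_subsingleton
        (fun i l => l.var = (w, Sum.inl i)) ?_ ?_
      · intro i hi
        obtain ⟨b, hb⟩ := (mem_filter.1 hi).2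
        exact ⟨_, mem_filter.2 ⟨hb, i, rfl⟩, rfl⟩
      · intro l _ i hi j hj
        have := hi.2.symm.trans hj.2
        simpa using this
    have h₂ : Y.card ≤ (q.filter fun l => ¬ ∃ i, l.var.2 = Sum.inl i).card := by
      refine Finset.card_le_card_of_forall_subsingleton
        (fun τ l => ∃ i, l.var = (w, Sum.inr (τ, i))) ?_ ?_
      · intro τ hτ
        obtain ⟨i, b, hb⟩ := (mem_filter.1 hτ).2
        exact ⟨_, mem_filter.2 ⟨hb, by simp⟩, i, rfl⟩
      · rintro l _ i ⟨_, i', hi⟩ j ⟨_, j', hj⟩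
        have := hi.symm.trans hj
        simp only [Prod.mk.injEq, Sum.inr.injEq, true_and] at this
        exact this.1
    have := Finset.card_filter_add_card_filter_not (s := q) (fun l => ∃ i, l.var.2 = Sum.inl i)
    omega
  have hYX : Fintype.card Y ≤ Fintype.card (Xᶜ : Finset (Fin k)) := by
    have := X.card_compl_add_card
    simp only [Fintype.card_coe, Fintype.card_fin] at *
    omega
  obtain ⟨g⟩ := Function.Embedding.nonempty_of_card_le hYX
  refine ⟨fun i => if i ∈ X then decide ((⟨(w, Sum.inl i), true⟩ : Lit (RelVar k W I)) ∈ q) else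
    if h : ∃ τ : Y, (g τ : Fin k) = i then !(h.choose : Fin k → Bool) i else false, ?_, ?_⟩
  · intro i b hb
    have : i ∈ X := by simp only [hX, mem_filter, mem_univ, true_and]; exact ⟨b, hb⟩
    simp [this]
  · intro τ i b hb heq
    have hτ : τ ∈ Y := by simp only [hY, mem_filter, mem_univ, true_and]; exact ⟨i, b, hb⟩
    set x : Fin k := (g ⟨τ, hτ⟩ : Fin k) with hx
    have hxX : x ∉ X := mem_compl.1 (g ⟨τ, hτ⟩).2
    have hex : ∃ τ : Y, (g τ : Fin k) = x := ⟨⟨τ, hτ⟩, rfl⟩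
    have hch : hex.choose = ⟨τ, hτ⟩ := g.injective (Subtype.ext hex.choose_spec)
    have := congrFun heq x
    rw [if_neg hxX, dif_pos hex, hch] at this
    simp at this

theorem exists_subcube {q : PTerm (RelVar k W I)} (hq : q.card ≤ k) (hcons : Consistent q) :
    ∃ (S : Finset (RelVar k W I)) (p : RelVar k W I → Bool), S.card ≤ k * k + k ∧
      (∀ v ∈ S, v.1 ∈ blocks q) ∧
      ∀ ρ : RelVar k W I → Bool, (∀ v ∈ S, ρ v = p v) → satPTerm (view ρ fun _ => none) q := by
  choose σ hσ₁ hσ₂ using exists_selector hq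
  let p : RelVar k W I → Bool := fun v => match v with
    | (w, Sum.inl i) => σ w i
    | (w, Sum.inr x) => decide ((⟨(w, Sum.inr x), true⟩ : Lit (RelVar k W I)) ∈ q)
  refine ⟨(blocks q ×ˢ univ).image (fun x : W × Fin k => (x.1, Sum.inl x.2)) ∪ q.image Lit.var,
    p, ?_, ?_, ?_⟩
  · refine (card_union_le _ _).trans (Nat.add_le_add ?_ (card_image_le.trans hq))
    refine card_image_le.trans ?_
    rw [card_product, card_univ, Fintype.card_fin]
    exact Nat.mul_le_mul_right _ (card_image_le.trans hq)
  · intro v hv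
    rcases mem_union.1 hv with hv | hv
    · obtain ⟨x, hx, rfl⟩ := mem_image.1 hv
      exact (mem_product.1 hx).1
    · obtain ⟨l, hl, rfl⟩ := mem_image.1 hv
      exact mem_image.2 ⟨l, hl, rfl⟩
  · intro ρ hρ l hl
    have hpos : ∀ b : Bool, ∀ v, (⟨v, b⟩ : Lit (RelVar k W I)) ∈ q →
        decide ((⟨v, true⟩ : Lit (RelVar k W I)) ∈ q) = b := by
      intro b v hb
      cases b
      · have := hcons _ hb
        simpa [Lit.neg] using this
      · simpa using hb
    have hlv := hρ l.var (mem_union_right _ (mem_image.2 ⟨l, hl, rfl⟩))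
    obtain ⟨⟨w, i | ⟨τ, i⟩⟩, b⟩ := l
    · simp only [litSatP, view, hlv, p]
      rw [hσ₁ w i b hl, hpos b _ hl]
    · have hsel : selOf ρ w = σ w := by
        funext j
        refine hρ (w, Sum.inl j) (mem_union_left _ (mem_image.2 ⟨(w, j), ?_, rfl⟩))
        exact mem_product.2 ⟨mem_image.2 ⟨_, hl, rfl⟩, mem_univ _⟩
      have hne := hσ₂ w τ i b hl
      simp only [litSatP, view, hsel, if_neg hne, hlv, p]
      rw [hpos b _ hl]

/-- The number of questions needed by `j`-DNFs outside a set of restrictions of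
density `2⁻ᵉ`, where `v` is the number of variables of a block. -/
def queryBound (k v : ℕ) : ℕ → ℕ → ℕ
  | 0, _ => 0
  | j + 1, e => k * (2 ^ (k * k + k) * e) +
      queryBound k v j (e + k * (2 ^ (k * k + k) * e) * v)

theorem decided_of_empty_mem {P : Set (Position W I)} {M : ℕ} {ρ : RelVar k W I → Bool} {h : ℕ}
    {G : Dnf (RelVar k W I)} (hG : ∅ ∈ G) : Decided P M ρ h G := by
  intro α hα _
  refine ⟨α, hα, fun _ _ h => h, by omega, fun _ => none, by simp [Extends], by simp [dom], ?_⟩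
  exact Or.inl ⟨∅, hG, by simp [satPTerm]⟩

/-- Fixing the blocks in a set meeting all consistent terms reduces the decision problem. -/
theorem decided_of_restrict {P : Set (Position W I)} {M : ℕ} (hP : Strategy P M)
    {ρ : RelVar k W I → Bool} {h : ℕ} {G : Dnf (RelVar k W I)} (H : Finset W)
    (hdec : ∀ a : RelVar k W I → Bool,
      Decided P M ρ h (restrictDnf (G.filter Consistent)
        (fun v => if v.1 ∈ H then some (a v) else none))) :
    Decided P M ρ (H.card + h) G := by
  intro α hα hcard
  obtain ⟨α₁, hα₁, hext₁, hH, hdom₁⟩ := hP.exists_extends H α hα (by omega)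
  have hc₁ : (dom α₁).card ≤ (dom α).card + H.card := by
    have h₁ := card_le_card hdom₁
    have h₂ := card_union_le H (dom α)
    omega
  set a : RelVar k W I → Bool := fun v => (view ρ α₁ v).getD false with ha
  obtain ⟨α₂, hα₂, hext₂, hc₂, β₂, hβ₂, hβ₂c, hd⟩ := hdec a α₁ hα₁ (by omega)
  refine ⟨α₂, hα₂, hext₁.trans hext₂, by omega, α₂.restrict (H ∪ dom β₂),
    restrict_extends _ _, ?_, ?_⟩
  · refine (card_le_card (dom_restrict_subset _ _)).trans ((card_union_le _ _).trans ?_)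
    omega
  have hβ : Extends β₂ (α₂.restrict (H ∪ dom β₂)) := hβ₂.restrict subset_union_right
  set β := α₂.restrict (H ∪ dom β₂)
  have hview : ∀ v : RelVar k W I, v.1 ∈ H → view ρ β v = some (a v) := by
    intro v hv
    have hβv : Extends (α₁.restrict H) β :=
      ((restrict_extends α₁ H).trans hext₂).restrict
        ((dom_restrict_subset _ _).trans subset_union_left)
    refine hβv.view ρ v _ ?_
    obtain ⟨d, hd⟩ := Option.ne_none_iff_exists'.1 (mem_dom.1 (hH hv))
    obtain ⟨w, i | ⟨τ, i⟩⟩ := v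
    · simp [ha, view]
    · simp only at hv hd
      simp only [ha, view, Position.restrict, if_pos hv, hd, Option.map_some]
      split_ifs <;> rfl
  rcases hd with hd | hd
  · left
    obtain ⟨q', hq', hsat⟩ := hd.mono (hβ.view ρ)
    simp only [restrictDnf, mem_image, mem_filter] at hq'
    obtain ⟨q, ⟨⟨hqG, -⟩, hnf⟩, rfl⟩ := hq'
    refine ⟨q, hqG, fun l hl => ?_⟩
    by_cases hl' : litSatP (fun v : RelVar k W I => if v.1 ∈ H then some (a v) else none) l
    · simp only [litSatP] at hl' ⊢
      split_ifs at hl' with hlH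
      rw [hview _ hlH, hl']
    · exact hsat l (mem_filter.2 ⟨hl, hl'⟩)
  · right
    have hd' := hd.mono (hβ.view ρ)
    intro q hq hcons
    by_cases hf : falsPTerm (fun v : RelVar k W I => if v.1 ∈ H then some (a v) else none) q
    · obtain ⟨l, hl, hlf⟩ := hf
      refine ⟨l, hl, ?_⟩
      simp only [litFalsP] at hlf ⊢
      split_ifs at hlf with hlH
      rw [hview _ hlH, hlf]
    · have hmem : (q.filter fun l =>
          ¬ litSatP (fun v : RelVar k W I => if v.1 ∈ H then some (a v) else none) l) ∈
          restrictDnf (G.filter Consistent)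
            (fun v => if v.1 ∈ H then some (a v) else none) := by
        simp only [restrictDnf, mem_image, mem_filter]
        exact ⟨q, ⟨⟨hq, hcons⟩, hf⟩, rfl⟩
      obtain ⟨l, hl, hlf⟩ := hd' _ hmem
        (fun l hl hneg => hcons l (mem_filter.1 hl).1 (mem_filter.1 hneg).1)
      exact ⟨l, (mem_filter.1 hl).1, hlf⟩

end Relativization

end ResKWeak

namespace ResKWeak

section LowerBound

variable {k : ℕ} {W I : Type} [Fintype W] [DecidableEq W] [Fintype I] [DecidableEq I]

theorem Decided.mono {P : Set (Position W I)} {M : ℕ} {ρ : RelVar k W I → Bool} {h h' : ℕ}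
    (hh : h ≤ h') {G : Dnf (RelVar k W I)} (hd : Decided P M ρ h G) : Decided P M ρ h' G := by
  intro α hα hcard
  obtain ⟨α', hα', hext, hc, β, hβ, hβc, hd⟩ := hd α hα (by omega)
  exact ⟨α', hα', hext, by omega, β, hβ, by omega, hd⟩

/-- Either many consistent terms have pairwise disjoint sets of blocks, or few blocks meet all
consistent terms. -/
theorem exists_disjoint_or_cover (G : Dnf (RelVar k W I)) (hG : ∅ ∉ G) {j : ℕ}
    (hj : ∀ q ∈ G, q.card ≤ j) (D : ℕ) :
    (∃ s ⊆ G.filter Consistent, D ≤ s.card ∧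
      ∀ q ∈ s, ∀ q' ∈ s, q ≠ q' → Disjoint (blocks q) (blocks q')) ∨
    ∃ H : Finset W, H.card ≤ j * D ∧ ∀ q ∈ G.filter Consistent, ∃ l ∈ q, l.var.1 ∈ H := by
  set F := (G.filter Consistent).powerset.filter fun s =>
    ∀ q ∈ s, ∀ q' ∈ s, q ≠ q' → Disjoint (blocks q) (blocks q') with hF
  obtain ⟨s, hs, hmax⟩ := Finset.exists_max_image F Finset.card ⟨∅, by simp [hF]⟩
  simp only [hF, mem_filter, mem_powerset] at hs hmax
  by_cases hD : D ≤ s.card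
  · exact Or.inl ⟨s, hs.1, hD, hs.2⟩
  right
  refine ⟨s.biUnion blocks, ?_, ?_⟩
  · refine (card_biUnion_le_card_mul s _ j fun q hq => ?_).trans ?_
    · exact card_image_le.trans (hj q (mem_filter.1 (hs.1 hq)).1)
    · rw [mul_comm]
      exact Nat.mul_le_mul_left _ (by omega)
  · intro q hq
    by_contra hcon
    push Not at hcon
    have hdis : ∀ q' ∈ s, Disjoint (blocks q) (blocks q') := by
      intro q' hq'
      rw [Finset.disjoint_left]
      intro w hw hw'
      obtain ⟨l, hl, rfl⟩ := mem_image.1 hw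
      exact hcon l hl (mem_biUnion.2 ⟨q', hq', hw'⟩)
    have hqs : q ∉ s := by
      intro hqs
      obtain ⟨l, hl⟩ : q.Nonempty := nonempty_iff_ne_empty.2 fun h =>
        hG (h ▸ (mem_filter.1 hq).1)
      exact hcon l hl (mem_biUnion.2 ⟨q, hqs, mem_image.2 ⟨l, hl, rfl⟩⟩)
    have := hmax (insert q s) ⟨insert_subset hq hs.1, by
      intro q₁ h₁ q₂ h₂ hne
      rcases mem_insert.1 h₁ with h₁' | h₁' <;> rcases mem_insert.1 h₂ with h₂' | h₂'
      · exact absurd (h₁'.trans h₂'.symm) hne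
      · exact h₁' ▸ hdis _ h₂'
      · exact h₂' ▸ (hdis _ h₁').symm
      · exact hs.2 _ h₁' _ h₂' hne⟩
    rw [card_insert_of_notMem hqs] at this
    omega

/-- The switching lemma for relativized variables. -/
theorem card_not_decided {P : Set (Position W I)} {M : ℕ} (hP : Strategy P M) (j : ℕ) :
    j ≤ k → ∀ (e : ℕ) (G : Dnf (RelVar k W I)), (∀ q ∈ G, q.card ≤ j) →
      (univ.filter fun ρ : RelVar k W I → Bool => ¬ Decided P M ρ
        (queryBound k (Fintype.card (Fin k ⊕ (Fin k → Bool) × I)) j e) G).card * 2 ^ e ≤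
      2 ^ Fintype.card (RelVar k W I) := by
  set v := Fintype.card (Fin k ⊕ (Fin k → Bool) × I) with hv
  have htriv : ∀ (h e : ℕ) (G : Dnf (RelVar k W I)),
      (∀ ρ : RelVar k W I → Bool, Decided P M ρ h G) →
      (univ.filter fun ρ : RelVar k W I → Bool => ¬ Decided P M ρ h G).card * 2 ^ e ≤
      2 ^ Fintype.card (RelVar k W I) := by
    intro h e G hd
    rw [filter_false_of_mem (fun ρ _ => not_not.2 (hd ρ))]
    simp
  induction j with
  | zero =>
    intro _ e G hG
    refine htriv _ _ _ fun ρ => ?_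
    by_cases h : ∅ ∈ G
    · exact decided_of_empty_mem h
    · intro α hα _
      refine ⟨α, hα, fun _ _ h => h, by omega, fun _ => none, by simp [Extends], by simp [dom],
        Or.inr fun q hq _ => ?_⟩
      have := hG q hq
      simp only [nonpos_iff_eq_zero, card_eq_zero] at this
      exact absurd (this ▸ hq) h
  | succ j ih =>
    intro hjk e G hG
    by_cases hempty : ∅ ∈ G
    · exact htriv _ _ _ fun ρ => decided_of_empty_mem hempty
    set D := 2 ^ (k * k + k) * e with hD
    rcases exists_disjoint_or_cover G hempty hG D with ⟨s, hsG, hsD, hdis⟩ | ⟨H, hHc, hH⟩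
    · have hcube : ∀ q : s, ∃ (S : Finset (RelVar k W I)) (p : RelVar k W I → Bool),
          S.card ≤ k * k + k ∧ (∀ v ∈ S, v.1 ∈ blocks q.1) ∧
          ∀ ρ : RelVar k W I → Bool, (∀ v ∈ S, ρ v = p v) →
            satPTerm (view ρ fun _ => none) q.1 := fun q =>
        exists_subcube ((hG _ (mem_filter.1 (hsG q.2)).1).trans hjk) (mem_filter.1 (hsG q.2)).2
      choose S p hSc hSb hSs using hcube
      refine le_trans (Nat.mul_le_mul_right _ (card_le_card ?_))
        (card_avoid_subcubes_le (k * k + k) e S p univ (fun q _ => hSc q) ?_ (by simpa using hsD))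
      · intro ρ hρ
        simp only [mem_filter, mem_univ, true_and] at hρ ⊢
        intro q _
        by_contra hcon
        push Not at hcon
        refine hρ fun α hα _ => ⟨α, hα, fun _ _ h => h, by omega, fun _ => none, by simp [Extends],
          by simp [dom], Or.inl ⟨q.1, (mem_filter.1 (hsG q.2)).1, hSs q ρ hcon⟩⟩
      · intro q _ q' _ hne
        rw [Finset.disjoint_left]
        intro x hx hx'
        exact Finset.disjoint_left.1 (hdis _ q.2 _ q'.2 (fun h => hne (Subtype.ext h)))
          (hSb q x hx) (hSb q' x hx')
    · have hHc' : H.card ≤ k * D := hHc.trans (Nat.mul_le_mul_right _ hjk)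
      set e' := e + k * D * v with he'
      let _ : DecidableEq {x : RelVar k W I // x.1 ∈ H} := Classical.decEq _
      let _ : Fintype {x : RelVar k W I // x.1 ∈ H} := Fintype.ofFinite _
      let _ : Fintype ({x : RelVar k W I // x.1 ∈ H} → Bool) := Pi.instFintype
      let ext : ({x : RelVar k W I // x.1 ∈ H} → Bool) → RelVar k W I → Bool :=
        fun τ x => if h : x.1 ∈ H then τ ⟨x, h⟩ else false
      let Gr : (RelVar k W I → Bool) → Dnf (RelVar k W I) := fun a =>
        restrictDnf (G.filter Consistent) (fun x => if x.1 ∈ H then some (a x) else none)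
      have hGr : ∀ a, Gr a = Gr (ext fun x => a x.1) := by
        intro a
        simp only [Gr]
        congr 1
        funext x
        by_cases hx : x.1 ∈ H <;> simp [ext, hx]
      have hGrc : ∀ a, ∀ q ∈ Gr a, q.card ≤ j := by
        intro a q hq
        simp only [Gr, restrictDnf, mem_image, mem_filter] at hq
        obtain ⟨q, ⟨⟨hqG, hqc⟩, hnf⟩, rfl⟩ := hq
        obtain ⟨l, hl, hlH⟩ := hH q (mem_filter.2 ⟨hqG, hqc⟩)
        refine Nat.le_of_lt_succ (lt_of_lt_of_le (card_lt_card ?_) (hG q hqG))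
        refine filter_ssubset.2 ⟨l, hl, not_not.2 ?_⟩
        by_contra hns
        refine hnf ⟨l, hl, ?_⟩
        simp only [litSatP, litFalsP, if_pos hlH, Option.some.injEq] at hns ⊢
        cases h1 : a l.var <;> cases h2 : l.pos <;> simp_all
      have hsub : (univ.filter fun ρ : RelVar k W I → Bool =>
          ¬ Decided P M ρ (queryBound k v (j + 1) e) G) ⊆
          univ.biUnion fun τ : {x : RelVar k W I // x.1 ∈ H} → Bool =>
            univ.filter fun ρ : RelVar k W I → Bool =>
              ¬ Decided P M ρ (queryBound k v j e') (Gr (ext τ)) := by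
        intro ρ hρ
        simp only [mem_filter, mem_univ, true_and, mem_biUnion] at hρ ⊢
        by_contra hcon
        push Not at hcon
        refine hρ ((decided_of_restrict hP H fun a => ?_).mono
          (Nat.add_le_add_right hHc' (queryBound k v j e')))
        have := hcon fun x => a x.1
        rw [← hGr] at this
        exact this
      have hcardτ : Fintype.card ({x : RelVar k W I // x.1 ∈ H} → Bool) ≤ 2 ^ (k * D * v) := by
        have h₁ : Fintype.card {x : RelVar k W I // x.1 ∈ H} = H.card * v := by
          rw [Fintype.card_subtype, hv, ← card_univ, ← card_product]
          congr 1
          ext x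
          simp
        rw [Fintype.card_fun, Fintype.card_bool, h₁]
        exact Nat.pow_le_pow_right (by norm_num) (Nat.mul_le_mul_right _ hHc')
      have hB : ∀ τ, (univ.filter fun ρ : RelVar k W I → Bool =>
          ¬ Decided P M ρ (queryBound k v j e') (Gr (ext τ))).card * 2 ^ e' ≤
          2 ^ Fintype.card (RelVar k W I) := fun τ =>
        ih (by omega) e' _ (hGrc _)
      refine Nat.le_of_mul_le_mul_right ?_ (show 0 < 2 ^ (k * D * v) by positivity)
      calc _ ≤ (∑ τ : {x : RelVar k W I // x.1 ∈ H} → Bool,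
            (univ.filter fun ρ : RelVar k W I → Bool =>
              ¬ Decided P M ρ (queryBound k v j e') (Gr (ext τ))).card) * 2 ^ e *
              2 ^ (k * D * v) := by
            gcongr
            exact (card_le_card hsub).trans card_biUnion_le
        _ = ∑ τ : {x : RelVar k W I // x.1 ∈ H} → Bool,
            (univ.filter fun ρ : RelVar k W I → Bool =>
              ¬ Decided P M ρ (queryBound k v j e') (Gr (ext τ))).card * 2 ^ e' := by
            rw [mul_assoc, ← pow_add, ← he', sum_mul]
        _ ≤ ∑ τ : {x : RelVar k W I // x.1 ∈ H} → Bool, 2 ^ Fintype.card (RelVar k W I) :=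
            sum_le_sum fun τ _ => hB τ
        _ = Fintype.card ({x : RelVar k W I // x.1 ∈ H} → Bool) *
            2 ^ Fintype.card (RelVar k W I) := by simp
        _ ≤ 2 ^ (k * D * v) * 2 ^ Fintype.card (RelVar k W I) := by gcongr
        _ = _ := mul_comm _ _

/-- Some restriction makes all lines of a short proof decidable. -/
theorem exists_forall_decided {P : Set (Position W I)} {M : ℕ} (hP : Strategy P M) {e : ℕ}
    (L : List (Dnf (RelVar k W I))) (hL : ∀ G ∈ L, IsKDnf k G) (hlen : L.length < 2 ^ e) :
    ∃ ρ : RelVar k W I → Bool, ∀ G ∈ L, Decided P M ρ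
      (queryBound k (Fintype.card (Fin k ⊕ (Fin k → Bool) × I)) k e) G := by
  by_contra hcon
  push Not at hcon
  set h := queryBound k (Fintype.card (Fin k ⊕ (Fin k → Bool) × I)) k e
  have hsub : (univ : Finset (RelVar k W I → Bool)) ⊆ L.toFinset.biUnion fun G =>
      univ.filter fun ρ : RelVar k W I → Bool => ¬ Decided P M ρ h G := by
    intro ρ _
    obtain ⟨G, hG, hd⟩ := hcon ρ
    simp only [mem_biUnion, List.mem_toFinset, mem_filter, mem_univ, true_and]
    exact ⟨G, hG, hd⟩
  have hcard := (card_le_card hsub).trans card_biUnion_le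
  rw [card_univ, Fintype.card_fun, Fintype.card_bool] at hcard
  have h₁ := Nat.mul_le_mul_right (2 ^ e) hcard
  rw [sum_mul] at h₁
  have h₂ : ∑ G ∈ L.toFinset, (univ.filter fun ρ : RelVar k W I → Bool =>
      ¬ Decided P M ρ h G).card * 2 ^ e ≤ L.toFinset.card * 2 ^ Fintype.card (RelVar k W I) := by
    rw [← smul_eq_mul]
    exact sum_le_card_nsmul _ _ _ fun G hG =>
      card_not_decided hP k le_rfl e G (hL G (List.mem_toFinset.1 hG))
  have h₃ : L.toFinset.card < 2 ^ e := (List.toFinset_card_le L).trans_lt hlen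
  have h₄ : L.toFinset.card * 2 ^ Fintype.card (RelVar k W I) <
      2 ^ e * 2 ^ Fintype.card (RelVar k W I) := Nat.mul_lt_mul_of_pos_right h₃ (by positivity)
  have := h₁.trans h₂
  rw [mul_comm] at this
  omega

theorem exists_decide_all {P : Set (Position W I)} {M h : ℕ}
    {ρ : RelVar k W I → Bool} (prems : List (Dnf (RelVar k W I)))
    (hd : ∀ Q ∈ prems, Decided P M ρ h Q) : ∀ α ∈ P, (dom α).card + prems.length * h ≤ M →
      ∃ α' ∈ P, Extends α α' ∧ ∀ Q ∈ prems, ∃ β, Extends β α' ∧ (dom β).card ≤ h ∧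
        (SatDnf (view ρ β) Q ∨ FalsDnf (view ρ β) Q) := by
  induction prems with
  | nil => exact fun α hα _ => ⟨α, hα, fun _ _ h => h, by simp⟩
  | cons Q prems ih =>
    intro α hα hcard
    rw [List.length_cons, add_mul, one_mul] at hcard
    obtain ⟨α₁, hα₁, hext₁, hc₁, β, hβ, hβc, hdβ⟩ := hd Q List.mem_cons_self α hα (by omega)
    obtain ⟨α₂, hα₂, hext₂, h₂⟩ := ih (fun Q hQ => hd Q (List.mem_cons_of_mem _ hQ)) α₁ hα₁
      (by omega)
    refine ⟨α₂, hα₂, hext₁.trans hext₂, fun Q' hQ' => ?_⟩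
    rcases List.mem_cons.1 hQ' with rfl | hQ'
    · exact ⟨β, hβ.trans hext₂, hβc, hdβ⟩
    · exact h₂ Q' hQ'

/-- An adversary strategy that never falsifies a clause yields a lower bound on the length of
refutations. -/
theorem Strategy.le_length {P : Set (Position W I)} {M : ℕ} (hP : Strategy P M) {e : ℕ}
    (hM : 3 * queryBound k (Fintype.card (Fin k ⊕ (Fin k → Bool) × I)) k e ≤ M)
    {F : Set (Clause (RelVar k W I))}
    (hF : ∀ (ρ : RelVar k W I → Bool), ∀ α ∈ P, ∀ C ∈ F, ¬ ∀ l ∈ C, litFalsP (view ρ α) l)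
    {L : List (Dnf (RelVar k W I))} (hL : IsResKRefutation k F L) : 2 ^ e ≤ L.length := by
  by_contra hlen
  obtain ⟨hne, hlast, hk, hinf⟩ := hL
  obtain ⟨ρ, hρ⟩ := exists_forall_decided hP L hk (not_le.1 hlen)
  set h := queryBound k (Fintype.card (Fin k ⊕ (Fin k → Bool) × I)) k e
  have key : ∀ (n : ℕ) (hn : n < L.length), ∀ β ∈ P, (dom β).card ≤ h →
      ¬ FalsDnf (view ρ β) (L.get ⟨n, hn⟩) := by
    intro n
    induction n using Nat.strong_induction_on with
    | _ n ih =>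
    intro hn β hβ hβc hfals
    rcases hinf ⟨n, hn⟩ with ⟨C, hC, hCe⟩ | ⟨prems, hinf, hprems⟩
    · refine hF ρ β hβ C hC fun l hl => ?_
      rw [hCe] at hfals
      have hcons : Consistent ({l} : PTerm (RelVar k W I)) := by
        intro l' hl' hneg
        rw [mem_singleton] at hl' hneg
        subst hl'
        have := congrArg Lit.pos hneg
        simp [Lit.neg] at this
      obtain ⟨l', hl', hf⟩ := hfals {l} (by simpa [clauseToDnf] using hl) hcons
      rw [mem_singleton] at hl'
      exact hl' ▸ hf
    · have hdec : ∀ Q ∈ prems, Decided P M ρ h Q := by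
        intro Q hQ
        obtain ⟨j, -, rfl⟩ := hprems Q hQ
        exact hρ _ (List.get_mem _ _)
      have hlen2 := resKInf_length_le hinf
      have hmul : prems.length * h ≤ 2 * h := Nat.mul_le_mul_right _ hlen2
      obtain ⟨α, hα, hext, hall⟩ := exists_decide_all prems hdec β hβ (by omega)
      have hex : ∃ Q ∈ prems, ∃ γ, Extends γ α ∧ (dom γ).card ≤ h ∧ FalsDnf (view ρ γ) Q := by
        by_contra hcon
        push Not at hcon
        set a : RelVar k W I → Bool := fun v => (view ρ α v).getD false
        have ha : ∀ v b, view ρ α v = some b → a v = b := by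
          intro v b hv
          simp [a, hv]
        refine not_evalDnf_of_falsDnf (hfals.mono (hext.view ρ)) ha (resKInf_sound hinf a fun Q hQ => ?_)
        obtain ⟨γ, hγ, hγc, hd⟩ := hall Q hQ
        rcases hd with hd | hd
        · exact evalDnf_of_satDnf (hd.mono (hγ.view ρ)) ha
        · exact absurd hd (hcon Q hQ γ hγ hγc)
      obtain ⟨Q, hQ, γ, hγ, hγc, hγf⟩ := hex
      obtain ⟨j, hj, rfl⟩ := hprems Q hQ
      exact ih j hj j.2 γ (hP.mono _ _ hγ hα) hγc hγf
  have hpos : 0 < L.length := List.length_pos_iff.2 hne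
  refine key (L.length - 1) (by omega) _ hP.empty (by simp [dom]) ?_
  have : L.get ⟨L.length - 1, by omega⟩ = ∅ := by
    rw [List.getLast?_eq_getElem?, List.getElem?_eq_getElem (by omega)] at hlast
    exact Option.some.inj hlast
  rw [this]
  intro q hq
  simp at hq

end LowerBound

end ResKWeak

namespace ResKWeak

section Reflection

instance {U : Type} [Fintype U] : Fintype (Lit U) :=
  Fintype.ofEquiv (U × Bool) ⟨fun x => ⟨x.1, x.2⟩, fun l => (l.var, l.pos), fun _ => rfl, fun _ => rfl⟩

theorem card_lit (U : Type) [Fintype U] : Fintype.card (Lit U) = Fintype.card U * 2 := by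
  rw [Fintype.ofEquiv_card, Fintype.card_prod, Fintype.card_bool]

/-- The clauses of a levelled refutation, `2 ^ r` of them on each of `n + 1` levels. -/
abbrev Node (n r : ℕ) : Type := Fin (n + 1) × (Fin r → Bool)

/-- The data of a node: the literals of its clause and two pointers to the next level. -/
abbrev NodeData (r : ℕ) (U : Type) : Type := Lit U ⊕ (Bool × Fin r)

abbrev RefVar (k n r : ℕ) (U : Type) : Type := RelVar k (Node n r) (NodeData r U)

instance (n r : ℕ) : DecidableEq (Node n r) := instDecidableEqProd

instance (r : ℕ) (U : Type) [DecidableEq U] : DecidableEq (NodeData r U) := instDecidableEqSum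

instance (k : ℕ) (W I : Type) [DecidableEq W] [DecidableEq I] : DecidableEq (RelVar k W I) :=
  instDecidableEqProd

def selNe {k : ℕ} {W I : Type} [DecidableEq W] [DecidableEq I] (w : W) (σ : Fin k → Bool) :
    Clause (RelVar k W I) :=
  univ.image fun i => ⟨(w, Sum.inl i), !σ i⟩

variable {k n r : ℕ} {U : Type} [DecidableEq U]

def ptrNe (w : Node n r) (σ : Fin k → Bool) (b : Bool) (u : Fin r → Bool) :
    Clause (RefVar k n r U) :=
  univ.image fun i => ⟨(w, Sum.inr (σ, Sum.inr (b, i))), !u i⟩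

def inClause (w : Node n r) (σ : Fin k → Bool) (l : Lit U) (s : Bool) : Lit (RefVar k n r U) :=
  ⟨(w, Sum.inr (σ, Sum.inl l)), s⟩

def stepClause (d : Fin n) (i : Fin r → Bool) (σ : Fin k → Bool) (b : Bool) (u : Fin r → Bool)
    (τ : Fin k → Bool) (l : Lit U) : Clause (RefVar k n r U) :=
  selNe (d.castSucc, i) σ ∪ ptrNe (d.castSucc, i) σ b u ∪ selNe (d.succ, u) τ ∪
    {inClause (d.succ, u) τ l false, inClause (d.castSucc, i) σ l true}

def leafClause (i : Fin r → Bool) (σ : Fin k → Bool) (u : Fin r → Bool) (l : Lit U) :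
    Clause (RefVar k n r U) :=
  selNe (Fin.last n, i) σ ∪ ptrNe (Fin.last n, i) σ false u ∪ {inClause (Fin.last n, i) σ l true}

def root : Node n r := (0, fun _ => false)

def rootClause (σ : Fin k → Bool) (l : Lit U) : Clause (RefVar k n r U) :=
  selNe root σ ∪ {inClause root σ l false}

/-- The statement that a relativized levelled refutation of the clauses `cl u` exists, which
resolves on the variable `ord d` on level `d`. -/
def reflection (k : ℕ) [Fintype U] (ord : Fin n → U) (cl : (Fin r → Bool) → Clause U) :
    Cnf (RefVar k n r U) :=
  ((univ.filter fun x : (Fin n × Bool) × Lit U => x.2 ≠ ⟨ord x.1.1, !x.1.2⟩) ×ˢ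
      (univ : Finset (((Fin r → Bool) × (Fin r → Bool)) × (Fin k → Bool) × (Fin k → Bool)))).image
    (fun x => stepClause x.1.1.1 x.2.1.1 x.2.2.1 x.1.1.2 x.2.1.2 x.2.2.2 x.1.2) ∪
  (univ.filter fun x : ((Fin r → Bool) × (Fin k → Bool) × (Fin r → Bool)) × Lit U =>
      x.2 ∈ cl x.1.2.2).image (fun x => leafClause x.1.1 x.1.2.1 x.1.2.2 x.2) ∪
  (univ : Finset ((Fin k → Bool) × Lit U)).image (fun x => rootClause x.1 x.2)

variable [Fintype U] {ord : Fin n → U} {cl : (Fin r → Bool) → Clause U}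

theorem mem_reflection {C : Clause (RefVar k n r U)} :
    C ∈ reflection k ord cl ↔
      (∃ d i σ b u τ l, l ≠ ⟨ord d, !b⟩ ∧ stepClause d i σ b u τ l = C) ∨
      (∃ i σ u l, l ∈ cl u ∧ leafClause i σ u l = C) ∨ ∃ σ l, rootClause σ l = C := by
  simp only [reflection, mem_union, mem_image, mem_product, mem_filter, mem_univ, true_and,
    and_true, Prod.exists, or_assoc]
  refine or_congr ⟨?_, ?_⟩ (or_congr ⟨?_, ?_⟩ Iff.rfl)
  · rintro ⟨d, b, l, i, u, σ, τ, h, rfl⟩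
    exact ⟨d, i, σ, b, u, τ, l, h, rfl⟩
  · rintro ⟨d, i, σ, b, u, τ, l, h, rfl⟩
    exact ⟨d, b, l, i, u, σ, τ, h, rfl⟩
  · rintro ⟨i, σ, u, l, h, rfl⟩
    exact ⟨i, σ, u, l, h, rfl⟩
  · rintro ⟨i, σ, u, l, h, rfl⟩
    exact ⟨i, σ, u, l, h, rfl⟩

theorem card_reflection_le :
    (reflection k ord cl).card ≤
      n * 2 * (Fintype.card U * 2) * (2 ^ r * 2 ^ r * (2 ^ k * 2 ^ k)) +
      2 ^ r * (2 ^ k * 2 ^ r) * (Fintype.card U * 2) + 2 ^ k * (Fintype.card U * 2) := by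
  refine (card_union_le _ _).trans (Nat.add_le_add ((card_union_le _ _).trans
    (Nat.add_le_add ?_ ?_)) ?_)
  · refine card_image_le.trans ?_
    rw [card_product]
    refine Nat.mul_le_mul ((card_filter_le _ _).trans ?_) ?_ <;>
      simp only [card_univ, Fintype.card_prod, Fintype.card_fun, Fintype.card_bool,
        Fintype.card_fin, card_lit, le_refl]
  · refine card_image_le.trans ((card_filter_le _ _).trans ?_)
    simp only [card_univ, Fintype.card_prod, Fintype.card_fun, Fintype.card_bool,
      Fintype.card_fin, card_lit, le_refl]
  · refine card_image_le.trans ?_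
    simp only [card_univ, Fintype.card_prod, Fintype.card_fun, Fintype.card_bool,
      Fintype.card_fin, card_lit, le_refl]

theorem card_relVar (k : ℕ) (W I : Type) [Fintype W] [Fintype I] :
    Fintype.card (RelVar k W I) = Fintype.card W * (k + 2 ^ k * Fintype.card I) := by
  simp

theorem card_nodeData (r : ℕ) (U : Type) [Fintype U] :
    Fintype.card (NodeData r U) = Fintype.card U * 2 + 2 * r := by
  simp [card_lit]

theorem card_node (n r : ℕ) : Fintype.card (Node n r) = (n + 1) * 2 ^ r := by
  simp

end Reflection

end ResKWeak

namespace ResKWeak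

section ReflectionLowerBound

variable {k n r : ℕ} {U : Type} [DecidableEq U] [Fintype U]

def pointer (d : NodeData r U → Bool) (b : Bool) : Fin r → Bool := fun i => d (Sum.inr (b, i))

/-- The data `d` of the node `w` is correct, if `X` assigns to each node an assignment that its
clause has to falsify. -/
structure LocallyCorrect (ord : Fin n → U) (cl : (Fin r → Bool) → Clause U)
    (X : Node n r → U → Bool) (w : Node n r) (d : NodeData r U → Bool) : Prop where
  mem_iff : ∀ l : Lit U, d (Sum.inl l) = true ↔
    X w l.var ≠ l.pos ∧ ∃ t : Fin n, t.castSucc < w.1 ∧ ord t = l.var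
  step : ∀ t : Fin n, w.1 = t.castSucc → ∀ b,
    X (t.succ, pointer d b) = Function.update (X w) (ord t) b
  leaf : w.1 = Fin.last n → ∀ l ∈ cl (pointer d false), X w l.var ≠ l.pos

def correctPositions (ord : Fin n → U) (cl : (Fin r → Bool) → Clause U) :
    Set (Position (Node n r) (NodeData r U)) :=
  {α | ∃ X, ∀ w d, α w = some d → LocallyCorrect ord cl X w d}

variable {ord : Fin n → U} {cl : (Fin r → Bool) → Clause U}

theorem forall_litFals_selNe {W I : Type} [DecidableEq W] [DecidableEq I]
    {ρ : RelVar k W I → Bool} {α : Position W I} {w : W} {σ : Fin k → Bool}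
    (h : ∀ l ∈ (selNe w σ : Clause (RelVar k W I)), litFalsP (view ρ α) l) : σ = selOf ρ w := by
  funext i
  have := h ⟨(w, Sum.inl i), !σ i⟩ (mem_image_of_mem _ (mem_univ i))
  simp only [litFalsP, view, Bool.not_not, Option.some.injEq] at this
  exact this.symm

theorem litFals_inClause {ρ : RefVar k n r U → Bool} {α : Position (Node n r) (NodeData r U)}
    {w : Node n r} {l : Lit U} {s : Bool}
    (h : litFalsP (view ρ α) (inClause w (selOf ρ w) l s)) :
    ∃ d, α w = some d ∧ d (Sum.inl l) = !s := by
  simpa only [litFalsP, view, inClause, if_pos, Option.map_eq_some_iff] using h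

theorem forall_litFals_ptrNe {ρ : RefVar k n r U → Bool} {α : Position (Node n r) (NodeData r U)}
    {w : Node n r} {b : Bool} {u : Fin r → Bool}
    (h : ∀ l ∈ (ptrNe w (selOf ρ w) b u : Clause (RefVar k n r U)), litFalsP (view ρ α) l)
    {d : NodeData r U → Bool} (hd : α w = some d) : u = pointer d b := by
  funext i
  have := h ⟨(w, Sum.inr (selOf ρ w, Sum.inr (b, i))), !u i⟩ (mem_image_of_mem _ (mem_univ i))
  simp only [litFalsP, view, if_pos, hd, Option.map_some, Bool.not_not, Option.some.injEq] at this
  exact this.symm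

theorem correctPositions_safe (hord : Function.Surjective ord) (ρ : RefVar k n r U → Bool)
    {α : Position (Node n r) (NodeData r U)} (hα : α ∈ correctPositions ord cl)
    {C : Clause (RefVar k n r U)} (hC : C ∈ reflection k ord cl) :
    ¬ ∀ l ∈ C, litFalsP (view ρ α) l := by
  intro hf
  obtain ⟨X, hX⟩ := hα
  rcases mem_reflection.1 hC with ⟨d, i, σ, b, u, τ, l, hl, rfl⟩ | ⟨i, σ, u, l, hl, rfl⟩ |
    ⟨σ, l, rfl⟩
  · simp only [stepClause, forall_mem_union, mem_insert, mem_singleton, forall_eq_or_imp,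
      forall_eq] at hf
    obtain ⟨⟨⟨h₁, h₂⟩, h₃⟩, h₄, h₅⟩ := hf
    obtain rfl := forall_litFals_selNe h₁
    obtain rfl := forall_litFals_selNe h₃
    obtain ⟨D', hD', hl'⟩ := litFals_inClause h₄
    obtain ⟨D, hD, hl₀⟩ := litFals_inClause h₅
    obtain rfl := forall_litFals_ptrNe h₂ hD
    obtain ⟨hx, t, ht, htl⟩ := ((hX _ _ hD').mem_iff l).1 hl'
    have hstep := (hX _ _ hD).step d rfl b
    rw [hstep] at hx
    by_cases hv : l.var = ord d
    · rw [hv, Function.update_self] at hx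
      refine hl ?_
      obtain ⟨v, p⟩ := l
      simp only at hv hx
      subst hv
      cases b <;> cases p <;> simp_all
    · rw [Function.update_of_ne hv] at hx
      have := ((hX _ _ hD).mem_iff l).2 ⟨hx, t, ?_, htl⟩
      · simp [this] at hl₀
      · have hne : t ≠ d := fun h => hv (by rw [← htl, h])
        simp only [Fin.lt_def, Fin.val_castSucc, Fin.val_succ] at ht ⊢
        have := Fin.val_ne_of_ne hne
        omega
  · simp only [leafClause, forall_mem_union, mem_singleton, forall_eq] at hf
    obtain ⟨⟨h₁, h₂⟩, h₃⟩ := hf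
    obtain rfl := forall_litFals_selNe h₁
    obtain ⟨D, hD, hl₀⟩ := litFals_inClause h₃
    obtain rfl := forall_litFals_ptrNe h₂ hD
    obtain ⟨t, ht⟩ := hord l.var
    have := ((hX _ _ hD).mem_iff l).2 ⟨(hX _ _ hD).leaf rfl l hl, t, Fin.castSucc_lt_last t, ht⟩
    simp [this] at hl₀
  · simp only [rootClause, forall_mem_union, mem_singleton, forall_eq] at hf
    obtain ⟨h₁, h₂⟩ := hf
    obtain rfl := forall_litFals_selNe h₁
    obtain ⟨D, hD, hl₀⟩ := litFals_inClause h₂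
    obtain ⟨-, t, ht, -⟩ := ((hX _ _ hD).mem_iff l).1 hl₀
    exact absurd ht (by simp [root])

theorem LocallyCorrect.congr {X X' : Node n r → U → Bool} {w : Node n r}
    {d : NodeData r U → Bool} (h : LocallyCorrect ord cl X w d) (hw : X' w = X w)
    (hc : ∀ t : Fin n, ∀ b, X' (t.succ, pointer d b) = X (t.succ, pointer d b)) :
    LocallyCorrect ord cl X' w d where
  mem_iff := by rw [hw]; exact h.mem_iff
  step t ht b := by rw [hw, hc]; exact h.step t ht b
  leaf := by rw [hw]; exact h.leaf

/-- Nodes that are neither in the domain of `α` nor pointed to by data of `α`. -/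
theorem exists_fresh {M : ℕ} (hr : 3 * M + 2 ≤ 2 ^ r) {α : Position (Node n r) (NodeData r U)}
    (hα : (dom α).card ≤ M) : ∃ u : Bool → Fin r → Bool, u false ≠ u true ∧
      ∀ w d, α w = some d → ∀ b, w.2 ≠ u b ∧ ∀ b', pointer d b' ≠ u b := by
  set S : Finset (Fin r → Bool) := (dom α).biUnion fun w =>
    {w.2, pointer ((α w).getD fun _ => false) false,
      pointer ((α w).getD fun _ => false) true} with hS
  have hSc : S.card ≤ (dom α).card * 3 := card_biUnion_le_card_mul _ _ _ fun w _ => card_le_three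
  have hcompl : 1 < Sᶜ.card := by
    have := S.card_compl_add_card
    simp only [Fintype.card_fun, Fintype.card_bool, Fintype.card_fin] at this
    omega
  obtain ⟨a, ha, b, hb, hab⟩ := Finset.one_lt_card.1 hcompl
  refine ⟨fun c => if c then b else a, by simpa using hab, fun w d hwd c => ?_⟩
  have hc : ∀ x ∈ S, x ≠ if c then b else a := by
    rintro x hx rfl
    cases c
    · exact mem_compl.1 ha (by simpa using hx)
    · exact mem_compl.1 hb (by simpa using hx)
  refine ⟨hc _ ?_, fun b' => hc _ ?_⟩ <;>
    refine mem_biUnion.2 ⟨w, mem_dom.2 (by simp [hwd]), ?_⟩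
  · simp
  · cases b' <;> simp [hwd]

theorem strategy_correctPositions {M : ℕ} (hr : 3 * M + 2 ≤ 2 ^ r)
    (hcl : ∀ x : U → Bool, ∃ u, ∀ l ∈ cl u, x l.var ≠ l.pos) :
    Strategy (correctPositions ord cl) M where
  empty := ⟨fun _ _ => false, by simp⟩
  mono := by
    rintro α β hαβ ⟨X, hX⟩
    exact ⟨X, fun w d h => hX w d (hαβ w d h)⟩
  ext := by
    rintro α ⟨X, hX⟩ hM w
    by_cases hw : w ∈ dom α
    · exact ⟨α, ⟨X, hX⟩, fun _ _ h => h, hw, subset_insert _ _⟩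
    have hwn : α w = none := by
      by_contra h
      exact hw (mem_dom.2 h)
    have hsuff : ∀ X' d, LocallyCorrect ord cl X' w d →
        (∀ w' d', α w' = some d' → LocallyCorrect ord cl X' w' d') →
        ∃ β ∈ correctPositions ord cl, Extends α β ∧ w ∈ dom β ∧ dom β ⊆ insert w (dom α) := by
      intro X' d hd hα
      refine ⟨Function.update α w (some d), ⟨X', fun w' d' h => ?_⟩, fun w' d' h => ?_, ?_, ?_⟩
      · by_cases hww : w' = w
        · subst hww
          rw [Function.update_self] at h
          exact Option.some.inj h ▸ hd
        · rw [Function.update_of_ne hww] at h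
          exact hα _ _ h
      · rw [Function.update_of_ne, h]
        rintro rfl
        simp [hwn] at h
      · exact mem_dom.2 (by simp)
      · intro w' hw'
        by_cases hww : w' = w
        · simp [hww]
        · rw [mem_dom, Function.update_of_ne hww] at hw'
          exact mem_insert_of_mem (mem_dom.2 hw')
    obtain ⟨u, hne, hu⟩ := exists_fresh hr hM.le
    obtain ⟨v, hv⟩ := hcl (X w)
    let inC : Lit U → Bool := fun l =>
      decide (X w l.var ≠ l.pos ∧ ∃ t : Fin n, t.castSucc < w.1 ∧ ord t = l.var)
    rcases Fin.eq_castSucc_or_eq_last w.1 with ⟨t, ht⟩ | hlast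
    · let X' : Node n r → U → Bool := fun w' =>
        if w'.1 = t.succ ∧ w'.2 = u false then Function.update (X w) (ord t) false else
        if w'.1 = t.succ ∧ w'.2 = u true then Function.update (X w) (ord t) true else X w'
      have hX'w : X' w = X w := by
        have : w.1 ≠ t.succ := by
          rw [ht]
          exact (Fin.castSucc_lt_succ).ne
        simp [X', this]
      refine hsuff X' (Sum.elim inC fun x => u x.1 x.2) ⟨?_, ?_, ?_⟩ fun w' d' hw' => ?_
      · simp [hX'w, inC]
      · intro t' ht' b
        obtain rfl : t' = t := Fin.castSucc_injective _ (ht'.symm.trans ht)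
        have : pointer (Sum.elim inC fun x => u x.1 x.2) b = u b := rfl
        rw [hX'w, this]
        cases b
        · simp [X']
        · simp [X', hne.symm]
      · intro h
        rw [ht] at h
        exact absurd h (Fin.castSucc_lt_last t).ne
      · obtain h := hu w' d' hw'
        refine (hX w' d' hw').congr ?_ ?_
        · simp [X', (h false).1, (h true).1]
        · intro t' b
          simp [X', (h false).2 b, (h true).2 b]
    · refine hsuff X (Sum.elim inC fun x => v x.2) ⟨?_, ?_, ?_⟩ hX
      · simp [inC]
      · intro t ht
        rw [hlast] at ht
        exact absurd ht.symm (Fin.castSucc_lt_last t).ne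
      · intro _
        exact hv

/-- Relativized reflection formulas of unsatisfiable CNFs require long refutations. -/
theorem reflection_le_length (hord : Function.Surjective ord)
    (hcl : ∀ x : U → Bool, ∃ u, ∀ l ∈ cl u, x l.var ≠ l.pos) {e : ℕ}
    (hr : 3 * (3 * queryBound k (k + 2 ^ k * (Fintype.card U * 2 + 2 * r)) k e) + 2 ≤ 2 ^ r)
    {L : List (Dnf (RefVar k n r U))}
    (hL : IsResKRefutation k (↑(reflection k ord cl) : Set (Clause (RefVar k n r U))) L) :
    2 ^ e ≤ L.length := by
  refine (strategy_correctPositions (ord := ord) hr hcl).le_length ?_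
    (fun ρ α hα C hC => correctPositions_safe hord ρ hα hC) hL
  simp [card_lit]

end ReflectionLowerBound

end ResKWeak

namespace ResKWeak

section Unsat

/-- Clauses stating that some `e i` holds, and that `e i` implies both `a i` and `¬ a i`. -/
def baseClause {n : ℕ} : (Fin n × Bool) ⊕ Unit → Clause (Fin n ⊕ Fin n)
  | Sum.inl (i, s) => {⟨Sum.inr i, false⟩, ⟨Sum.inl i, s⟩}
  | Sum.inr _ => univ.image fun i => ⟨Sum.inr i, true⟩

theorem exists_baseClause_falsified {n : ℕ} (x : Fin n ⊕ Fin n → Bool) :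
    ∃ c, ∀ l ∈ baseClause c, x l.var ≠ l.pos := by
  by_cases h : ∃ i, x (Sum.inr i) = true
  · obtain ⟨i, hi⟩ := h
    refine ⟨Sum.inl (i, !x (Sum.inl i)), ?_⟩
    simp [baseClause, hi]
  · push Not at h
    refine ⟨Sum.inr (), ?_⟩
    simpa [baseClause] using h

variable {N r : ℕ} {U : Type}

/-- The path through a levelled refutation determined by an assignment. -/
def path (next : Fin N → (Fin r → Bool) → Bool → Fin r → Bool) (ord : Fin N → U)
    (x : U → Bool) : ℕ → Fin r → Bool
  | 0 => fun _ => false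
  | t + 1 => if h : t < N then next ⟨t, h⟩ (path next ord x t) (x (ord ⟨t, h⟩)) else
      fun _ => false

theorem path_congr {next : Fin N → (Fin r → Bool) → Bool → Fin r → Bool} {ord : Fin N → U}
    {x x' : U → Bool} {s t : ℕ} (hst : s ≤ t) (hs : path next ord x s = path next ord x' s)
    (h : ∀ q : Fin N, s ≤ q.1 → q.1 < t → x (ord q) = x' (ord q)) :
    path next ord x t = path next ord x' t := by
  induction t, hst using Nat.le_induction with
  | base => exact hs
  | succ t hst ih =>
    have ih := ih fun q hq hq' => h q hq (by omega)
    simp only [path]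
    split_ifs with ht
    · rw [ih, h ⟨t, ht⟩ hst (by simp)]
    · rfl

variable {k : ℕ} [DecidableEq U] [Fintype U]

/-- In a satisfying assignment of a reflection formula, every assignment to the variables of the
refuted CNF leads to a falsified clause. -/
theorem exists_next_of_satisfied {ord : Fin N → U} {cl : (Fin r → Bool) → Clause U}
    {ρ : RefVar k N r U → Bool} (hρ : ∀ C ∈ reflection k ord cl, SatClauseA ρ C) :
    ∃ (next : Fin N → (Fin r → Bool) → Bool → Fin r → Bool) (leaf : (Fin r → Bool) → Fin r → Bool),
      ∀ x : U → Bool, ∀ l ∈ cl (leaf (path next ord x N)), x l.var ≠ l.pos := by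
  let y : Node N r → Lit U → Bool := fun w l => ρ (w, Sum.inr (selOf ρ w, Sum.inl l))
  let ptr : Node N r → Bool → Fin r → Bool := fun w b i =>
    ρ (w, Sum.inr (selOf ρ w, Sum.inr (b, i)))
  have hsel : ∀ w, ∀ l ∈ (selNe w (selOf ρ w) : Clause (RefVar k N r U)), ρ l.var ≠ l.pos := by
    intro w l hl
    obtain ⟨i, -, rfl⟩ := mem_image.1 hl
    simp [selOf]
  have hptr : ∀ w b, ∀ l ∈ (ptrNe w (selOf ρ w) b (ptr w b) : Clause (RefVar k N r U)),
      ρ l.var ≠ l.pos := by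
    intro w b l hl
    obtain ⟨i, -, rfl⟩ := mem_image.1 hl
    simp [ptr]
  have hstep : ∀ (d : Fin N) i b l, l ≠ ⟨ord d, !b⟩ → y (d.succ, ptr (d.castSucc, i) b) l = true →
      y (d.castSucc, i) l = true := by
    intro d i b l hl hy
    obtain ⟨l', hl', hs⟩ := hρ _ (mem_reflection.2 (Or.inl ⟨d, i, selOf ρ (d.castSucc, i), b,
      ptr (d.castSucc, i) b, selOf ρ (d.succ, ptr (d.castSucc, i) b), l, hl, rfl⟩))
    simp only [stepClause, mem_union, mem_insert, mem_singleton] at hl'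
    rcases hl' with ((hl' | hl') | hl') | rfl | rfl
    · exact absurd hs (hsel _ _ hl')
    · exact absurd hs (hptr _ _ _ hl')
    · exact absurd hs (hsel _ _ hl')
    · rw [show y _ l = false from hs] at hy
      exact absurd hy (by simp)
    · exact hs
  have hleaf : ∀ i, ∀ l ∈ cl (ptr (Fin.last N, i) false), y (Fin.last N, i) l = true := by
    intro i l hl
    obtain ⟨l', hl', hs⟩ := hρ _ (mem_reflection.2 (Or.inr (Or.inl ⟨i, selOf ρ (Fin.last N, i),
      ptr (Fin.last N, i) false, l, hl, rfl⟩)))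
    simp only [leafClause, mem_union, mem_singleton] at hl'
    rcases hl' with (hl' | hl') | rfl
    · exact absurd hs (hsel _ _ hl')
    · exact absurd hs (hptr _ _ _ hl')
    · exact hs
  have hroot : ∀ l, y root l = false := by
    intro l
    obtain ⟨l', hl', hs⟩ := hρ _ (mem_reflection.2 (Or.inr (Or.inr ⟨selOf ρ root, l, rfl⟩)))
    simp only [rootClause, mem_union, mem_singleton] at hl'
    rcases hl' with hl' | rfl
    · exact absurd hs (hsel _ _ hl')
    · exact hs
  refine ⟨fun d i b => ptr (d.castSucc, i) b, fun i => ptr (Fin.last N, i) false, fun x => ?_⟩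
  set p := path (fun d i b => ptr (d.castSucc, i) b) ord x with hp
  have inv : ∀ t (ht : t < N + 1) l, y (⟨t, ht⟩, p t) l = true → x l.var ≠ l.pos := by
    intro t
    induction t with
    | zero =>
      intro ht l hl
      have := hroot l
      rw [show y root l = true from hl] at this
      exact absurd this (by simp)
    | succ t ih =>
      intro ht l hl
      have ht' : t < N := by omega
      have hpt : p (t + 1) = ptr (Fin.castSucc ⟨t, ht'⟩, p t) (x (ord ⟨t, ht'⟩)) := by
        simp only [hp, path, dif_pos ht']
      rw [hpt] at hl
      by_cases hlo : l = ⟨ord ⟨t, ht'⟩, !x (ord ⟨t, ht'⟩)⟩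
      · subst hlo
        simp
      · exact ih (by omega) l (hstep ⟨t, ht'⟩ _ _ _ hlo hl)
  exact fun l hl => inv N (by omega) l (hleaf _ l hl)

/-- There is no levelled refutation of width less than `2 ^ n` querying all `a i` before
all `e i`. -/
theorem reflection_base_unsat {n : ℕ} (hrn : r < n)
    (g : (Fin r → Bool) → (Fin n × Bool) ⊕ Unit) (ρ : RefVar k (n + n) r (Fin n ⊕ Fin n) → Bool) :
    ∃ C ∈ reflection k finSumFinEquiv.symm fun u => baseClause (g u), ¬ SatClauseA ρ C := by
  by_contra hcon
  push Not at hcon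
  obtain ⟨next, leaf, hleaf⟩ := exists_next_of_satisfied hcon
  obtain ⟨a, a', hne, heq⟩ := Fintype.exists_ne_map_eq_of_card_lt
    (fun a : Fin n → Bool => path next finSumFinEquiv.symm (Sum.elim a fun _ => false) n)
    (by simpa using Nat.pow_lt_pow_right one_lt_two hrn)
  obtain ⟨i, hi⟩ := Function.ne_iff.1 hne
  let e : Fin n → Bool := fun j => decide (j = i)
  have hsame : ∀ a : Fin n → Bool, path next finSumFinEquiv.symm (Sum.elim a e) n =
      path next finSumFinEquiv.symm (Sum.elim a fun _ => false) n := by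
    refine fun a => path_congr (Nat.zero_le n) rfl fun q _ hq => ?_
    obtain ⟨c, rfl⟩ := finSumFinEquiv.surjective q
    rcases c with c | c
    · simp
    · simp at hq
  have hpath : path next finSumFinEquiv.symm (Sum.elim a e) (n + n) =
      path next finSumFinEquiv.symm (Sum.elim a' e) (n + n) := by
    refine path_congr (Nat.le_add_right n n) ?_ fun q hq _ => ?_
    · rw [hsame, hsame]
      exact heq
    · obtain ⟨c, rfl⟩ := finSumFinEquiv.surjective q
      rcases c with c | c
      · simp only [finSumFinEquiv_apply_left, Fin.val_castAdd] at hq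
        omega
      · rw [Equiv.symm_apply_apply, Sum.elim_inr, Sum.elim_inr]
  have h₁ := hleaf (Sum.elim a e)
  have h₂ := hleaf (Sum.elim a' e)
  rw [hpath] at h₁
  generalize g (leaf (path next finSumFinEquiv.symm (Sum.elim a' e) (n + n))) = c at h₁ h₂
  rcases c with ⟨j, s⟩ | _
  · simp only [baseClause, mem_insert, mem_singleton, forall_eq_or_imp, forall_eq, Sum.elim_inr,
      Sum.elim_inl] at h₁ h₂
    obtain rfl : j = i := by simpa [e] using h₁.1
    cases h : a j <;> cases h' : a' j <;> cases s <;> simp_all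
  · have := h₁ ⟨Sum.inr i, true⟩ (mem_image_of_mem _ (mem_univ i))
    simp [e] at this

end Unsat

end ResKWeak

namespace ResKWeak

section Renaming

variable {V' : Type} [DecidableEq V']

def mapLit (f : V → V') (l : Lit V) : Lit V' := ⟨f l.var, l.pos⟩

def mapClause (f : V → V') (C : Clause V) : Clause V' := C.image (mapLit f)

def mapDnf (f : V → V') (G : Dnf V) : Dnf V' := G.image (mapClause f)

theorem mapDnf_union (f : V → V') (G H : Dnf V) :
    mapDnf f (G ∪ H) = mapDnf f G ∪ mapDnf f H :=
  image_union _ _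

theorem mapDnf_singleton (f : V → V') (q : PTerm V) : mapDnf f {q} = {mapClause f q} :=
  image_singleton _ _

theorem mapDnf_clauseToDnf (f : V → V') (C : Clause V) :
    mapDnf f (clauseToDnf C) = clauseToDnf (mapClause f C) := by
  simp only [mapDnf, clauseToDnf, mapClause, image_image]
  congr 1

theorem mapClause_id (C : Clause V) : mapClause id C = C := by
  simp only [mapClause]
  exact image_id

theorem mapClause_mapClause {V'' : Type} [DecidableEq V''] (f : V → V') (g : V' → V'')
    (C : Clause V) : mapClause g (mapClause f C) = mapClause (g ∘ f) C := by
  simp only [mapClause, image_image]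
  rfl

theorem resKInf_map (f : V → V') {k : ℕ} {prems : List (Dnf V)} {G : Dnf V}
    (h : ResKInf k prems G) : ResKInf k (prems.map (mapDnf f)) (mapDnf f G) := by
  cases h with
  | ax x =>
    have : mapDnf f {{(⟨x, true⟩ : Lit V)}, {(⟨x, false⟩ : Lit V)}} =
        {{(⟨f x, true⟩ : Lit V')}, {(⟨f x, false⟩ : Lit V')}} := by
      simp [mapDnf, mapClause, mapLit]
    rw [this]
    exact ResKInf.ax (f x)
  | weaken A B =>
    rw [mapDnf_union]
    exact ResKInf.weaken _ _
  | andIntro A B l q hq =>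
    simp only [List.map_cons, List.map_nil, mapDnf_union, mapDnf_singleton]
    have h₁ : mapClause f {l} = {mapLit f l} := image_singleton _ _
    have h₂ : mapClause f (insert l q) = insert (mapLit f l) (mapClause f q) := image_insert _ _ _
    rw [h₁, h₂]
    exact ResKInf.andIntro _ _ _ _ ((Nat.add_le_add_right card_image_le 1).trans hq)
  | cut A B q =>
    simp only [List.map_cons, List.map_nil, mapDnf_union, mapDnf_singleton]
    have : mapDnf f (q.image fun l => ({l.neg} : PTerm V)) =
        (mapClause f q).image fun l => ({l.neg} : PTerm V') := by
      simp only [mapDnf, mapClause, image_image]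
      congr 1
    rw [this]
    exact ResKInf.cut _ _ _

theorem isResKRefutation_map (f : V → V') {k : ℕ} {F : Set (Clause V)} {F' : Set (Clause V')}
    (hF : ∀ C ∈ F, mapClause f C ∈ F') {P : List (Dnf V)} (hP : IsResKRefutation k F P) :
    IsResKRefutation k F' (P.map (mapDnf f)) := by
  obtain ⟨hne, hlast, hk, hinf⟩ := hP
  refine ⟨by simpa using hne, ?_, ?_, fun i => ?_⟩
  · rw [List.getLast?_map, hlast]
    simp [mapDnf]
  · intro G hG q hq
    obtain ⟨G₀, hG₀, rfl⟩ := List.mem_map.1 hG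
    obtain ⟨q, hq', rfl⟩ := mem_image.1 hq
    exact card_image_le.trans (hk G₀ hG₀ q hq')
  · have hi : (i : ℕ) < P.length := by simpa using i.2
    have hget : ∀ j : Fin (P.map (mapDnf f)).length,
        (P.map (mapDnf f)).get j = mapDnf f (P.get ⟨j, by simpa using j.2⟩) := by
      simp
    rw [hget]
    rcases hinf ⟨i, hi⟩ with ⟨C, hC, hCe⟩ | ⟨prems, hprems, hj⟩
    · exact Or.inl ⟨_, hF C hC, by rw [hCe, mapDnf_clauseToDnf]⟩
    · refine Or.inr ⟨_, resKInf_map f hprems, fun Q hQ => ?_⟩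
      obtain ⟨Q, hQ', rfl⟩ := List.mem_map.1 hQ
      obtain ⟨j, hji, rfl⟩ := hj Q hQ'
      exact ⟨⟨j, by simp⟩, hji, by rw [hget]⟩

end Renaming

end ResKWeak

namespace ResKWeak

section Derivations

/-- Sequences of `k`-DNFs inferred from the clauses of `F`. -/
inductive Deriv (k : ℕ) (F : Set (Clause V)) : List (Dnf V) → Prop
  | nil : Deriv k F []
  | clause (L : List (Dnf V)) (C : Clause V) (hL : Deriv k F L) (hC : C ∈ F)
      (hk : IsKDnf k (clauseToDnf C)) : Deriv k F (L ++ [clauseToDnf C])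
  | infer (L : List (Dnf V)) (prems : List (Dnf V)) (G : Dnf V) (hL : Deriv k F L)
      (h : ResKInf k prems G) (hprems : ∀ Q ∈ prems, Q ∈ L) (hk : IsKDnf k G) :
      Deriv k F (L ++ [G])

variable {k : ℕ} {F : Set (Clause V)} {L : List (Dnf V)}

theorem Deriv.isKDnf (h : Deriv k F L) : ∀ G ∈ L, IsKDnf k G := by
  induction h with
  | nil => simp
  | clause L C _ _ hk ih =>
    intro G hG
    rcases List.mem_append.1 hG with hG | hG
    · exact ih G hG
    · exact List.mem_singleton.1 hG ▸ hk
  | infer L prems G _ _ _ hk ih =>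
    intro G' hG
    rcases List.mem_append.1 hG with hG | hG
    · exact ih G' hG
    · exact List.mem_singleton.1 hG ▸ hk

theorem Deriv.justified (h : Deriv k F L) : ∀ (i : ℕ) (G : Dnf V), L[i]? = some G →
    (∃ C ∈ F, G = clauseToDnf C) ∨ ∃ prems : List (Dnf V), ResKInf k prems G ∧
      ∀ Q ∈ prems, ∃ j < i, L[j]? = some Q := by
  have hold : ∀ (L : List (Dnf V)) (H : Dnf V),
      (∀ (i : ℕ) (G : Dnf V), L[i]? = some G →
        (∃ C ∈ F, G = clauseToDnf C) ∨ ∃ prems : List (Dnf V), ResKInf k prems G ∧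
          ∀ Q ∈ prems, ∃ j < i, L[j]? = some Q) →
      ((∃ C ∈ F, H = clauseToDnf C) ∨ ∃ prems : List (Dnf V), ResKInf k prems H ∧
          ∀ Q ∈ prems, Q ∈ L) →
      ∀ (i : ℕ) (G : Dnf V), (L ++ [H])[i]? = some G →
        (∃ C ∈ F, G = clauseToDnf C) ∨ ∃ prems : List (Dnf V), ResKInf k prems G ∧
          ∀ Q ∈ prems, ∃ j < i, (L ++ [H])[j]? = some Q := by
    intro L H ih hH i G hG
    have happ : ∀ (j : ℕ) (Q : Dnf V), L[j]? = some Q → (L ++ [H])[j]? = some Q := by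
      intro j Q hQ
      rw [List.getElem?_append_left (List.getElem?_eq_some_iff.1 hQ).1, hQ]
    by_cases hi : i < L.length
    · rw [List.getElem?_append_left hi] at hG
      refine (ih i G hG).imp_right ?_
      rintro ⟨prems, hp, hj⟩
      refine ⟨prems, hp, fun Q hQ => ?_⟩
      obtain ⟨j, hji, hj⟩ := hj Q hQ
      exact ⟨j, hji, happ j Q hj⟩
    · have hG' : H = G := by
        rw [List.getElem?_append_right (by omega)] at hG
        have := List.mem_of_getElem? hG
        exact (List.mem_singleton.1 this).symm
      subst hG'
      refine hH.imp_right ?_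
      rintro ⟨prems, hp, hj⟩
      refine ⟨prems, hp, fun Q hQ => ?_⟩
      obtain ⟨j, hj⟩ := List.mem_iff_getElem?.1 (hj Q hQ)
      have := (List.getElem?_eq_some_iff.1 hj).1
      exact ⟨j, by omega, happ j Q hj⟩
  induction h with
  | nil => simp
  | clause L C _ hC _ ih => exact hold L _ ih (Or.inl ⟨C, hC, rfl⟩)
  | infer L prems G _ h hprems _ ih => exact hold L _ ih (Or.inr ⟨prems, h, hprems⟩)

theorem Deriv.exists_refutation (h : Deriv k F L) (hL : ∅ ∈ L) :
    ∃ P, IsResKRefutation k F P ∧ P.length = L.length + 1 := by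
  have h' : Deriv k F (L ++ [∅]) := by
    refine Deriv.infer L [∅] ∅ h ?_ (by simpa using hL) (by simp [IsKDnf])
    simpa using ResKInf.weaken (k := k) (∅ : Dnf V) ∅
  refine ⟨L ++ [∅], ⟨by simp, by simp, h'.isKDnf, fun i => ?_⟩, by simp⟩
  refine (h'.justified i _ (by simp)).imp_right ?_
  rintro ⟨prems, hp, hj⟩
  refine ⟨prems, hp, fun Q hQ => ?_⟩
  obtain ⟨j, hji, hj⟩ := hj Q hQ
  obtain ⟨hlt, hjQ⟩ := List.getElem?_eq_some_iff.1 hj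
  exact ⟨⟨j, hlt⟩, hji, hjQ⟩

/-- From derivations containing the lines `Γ`, the line `G` is obtained by at most `c` further
steps. -/
def Reach (k : ℕ) (F : Set (Clause V)) (Γ : Set (Dnf V)) (c : ℕ) (G : Dnf V) : Prop :=
  ∀ L, Deriv k F L → (∀ Q ∈ Γ, Q ∈ L) → ∃ L', Deriv k F (L ++ L') ∧ L'.length ≤ c ∧ G ∈ L ++ L'

variable {Γ Γ' : Set (Dnf V)} {a b c : ℕ} {E X Y : Dnf V}

theorem Reach.hyp (h : X ∈ Γ) : Reach k F Γ 0 X :=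
  fun L hL hΓ => ⟨[], by simpa using hL, by simp, by simpa using hΓ X h⟩

theorem Reach.mono_cost (h : Reach k F Γ a X) (hab : a ≤ b) : Reach k F Γ b X := by
  intro L hL hΓ
  obtain ⟨L', h₁, h₂, h₃⟩ := h L hL hΓ
  exact ⟨L', h₁, h₂.trans hab, h₃⟩

theorem Reach.bind (h : Reach k F Γ a X) (h' : Reach k F (insert X Γ) b Y) :
    Reach k F Γ (a + b) Y := by
  intro L hL hΓ
  obtain ⟨L₁, h₁, hc₁, hX⟩ := h L hL hΓ
  obtain ⟨L₂, h₂, hc₂, hY⟩ := h' (L ++ L₁) h₁ (by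
    rintro Q (rfl | hQ)
    · exact hX
    · exact List.mem_append_left _ (hΓ Q hQ))
  refine ⟨L₁ ++ L₂, by rwa [← List.append_assoc], ?_, by rwa [← List.append_assoc]⟩
  rw [List.length_append]
  omega

theorem Reach.mono (h : Reach k F Γ a X) (hΓ : Γ ⊆ Γ') : Reach k F Γ' a X :=
  fun L hL hΓ' => h L hL fun Q hQ => hΓ' Q (hΓ hQ)

theorem Reach.bind_family {ι : Type} [DecidableEq ι] (s : Finset ι) (f : ι → Dnf V)
    (h : ∀ i ∈ s, Reach k F Γ a (f i)) (h' : Reach k F (Γ ∪ {G | ∃ i ∈ s, f i = G}) b Y) :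
    Reach k F Γ (s.card * a + b) Y := by
  induction s using Finset.induction_on generalizing b with
  | empty => simpa using h'
  | insert i s hi ih =>
    have h₁ : Reach k F (Γ ∪ {G | ∃ i ∈ s, f i = G}) (a + b) Y := by
      refine ((h i (mem_insert_self i s)).mono Set.subset_union_left).bind (h'.mono ?_)
      rintro G (hG | ⟨j, hj, rfl⟩)
      · exact Or.inr (Or.inl hG)
      · rcases mem_insert.1 hj with rfl | hj
        · exact Or.inl rfl
        · exact Or.inr (Or.inr ⟨j, hj, rfl⟩)
    refine (ih (fun j hj => h j (mem_insert_of_mem hj)) h₁).mono_cost ?_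
    rw [card_insert_of_notMem hi, add_mul]
    omega

theorem Reach.clause (hk : 1 ≤ k) {C : Clause V} (hC : C ∈ F) :
    Reach k F Γ 1 (clauseToDnf C) := by
  refine fun L hL _ => ⟨[clauseToDnf C], hL.clause _ _ hC ?_, le_rfl, by simp⟩
  intro q hq
  obtain ⟨l, -, rfl⟩ := mem_image.1 hq
  simpa using hk

theorem Reach.ax (hk : 1 ≤ k) (l : Lit V) :
    Reach k F Γ 1 {({l} : PTerm V), {l.neg}} := by
  have h : ({({l} : PTerm V), {l.neg}} : Dnf V) =
      {{(⟨l.var, true⟩ : Lit V)}, {(⟨l.var, false⟩ : Lit V)}} := by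
    obtain ⟨v, p⟩ := l
    cases p
    · exact pair_comm _ _
    · rfl
  rw [h]
  refine fun L hL _ => ⟨[_], hL.infer _ [] _ (ResKInf.ax l.var) (by simp) ?_, le_rfl, by simp⟩
  intro q hq
  rw [mem_insert, mem_singleton] at hq
  rcases hq with rfl | rfl <;> simpa using hk

theorem Reach.infer {prems : List (Dnf V)} (h : ResKInf k prems X) (hX : IsKDnf k X)
    (hprems : ∀ Q ∈ prems, Q ∈ Γ) : Reach k F Γ 1 X :=
  fun _ hL hΓ => ⟨[X], hL.infer _ prems _ h (fun Q hQ => hΓ Q (hprems Q hQ)) hX, le_rfl, by simp⟩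

theorem Reach.weaken (h : Reach k F Γ a X) (hXE : X ⊆ E) (hE : IsKDnf k E) :
    Reach k F Γ (a + 1) E := by
  refine h.bind (Reach.infer (prems := [X]) ?_ hE (by simp))
  have := ResKInf.weaken (k := k) X E
  rwa [union_eq_right.2 hXE] at this

theorem isKDnf_union {G H : Dnf V} (hG : IsKDnf k G) (hH : IsKDnf k H) : IsKDnf k (G ∪ H) := by
  intro q hq
  rcases mem_union.1 hq with hq | hq
  · exact hG q hq
  · exact hH q hq

theorem isKDnf_singleton {q : PTerm V} (hq : q.card ≤ k) : IsKDnf k {q} := by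
  intro q' hq'
  rw [mem_singleton] at hq'
  exact hq' ▸ hq

theorem isKDnf_image {ι : Type} {s : Finset ι} {g : ι → PTerm V} (h : ∀ i ∈ s, (g i).card ≤ k) :
    IsKDnf k (s.image g) := by
  intro q hq
  obtain ⟨i, hi, rfl⟩ := mem_image.1 hq
  exact h i hi

theorem Reach.weaken₂ (hX : Reach k F Γ a X) (hY : Reach k F Γ b Y) {X' Y' Z : Dnf V}
    (hXX : X ⊆ X') (hYY : Y ⊆ Y') (hX' : IsKDnf k X') (hY' : IsKDnf k Y') (hZ : IsKDnf k Z)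
    (h : ResKInf k [X', Y'] Z) : Reach k F Γ (a + b + 3) Z := by
  have h₁ := hX.weaken hXX hX'
  have h₂ := hY.weaken hYY hY'
  refine (h₁.bind ((h₂.mono (Set.subset_insert X' Γ)).bind
    (Reach.infer h hZ (by simp)))).mono_cost ?_
  omega

theorem Reach.cut (hk : 1 ≤ k) (hE : IsKDnf k E) {q : PTerm V} (hq : q.card ≤ k)
    (hX : Reach k F Γ a X) (hXE : X ⊆ E ∪ {q}) (hY : Reach k F Γ b Y)
    (hYE : Y ⊆ E ∪ q.image fun l => ({l.neg} : PTerm V)) : Reach k F Γ (a + b + 3) E := by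
  refine hX.weaken₂ hY hXE hYE (isKDnf_union hE (isKDnf_singleton hq))
    (isKDnf_union hE (isKDnf_image fun l _ => by simpa using hk)) hE ?_
  have := ResKInf.cut (k := k) E E q
  rwa [union_self] at this

theorem Reach.andIntro (hE : IsKDnf k E) {l : Lit V} {q : PTerm V} (hq : q.card + 1 ≤ k)
    (hX : Reach k F Γ a X) (hXE : X ⊆ E ∪ {({l} : PTerm V)}) (hY : Reach k F Γ b Y)
    (hYE : Y ⊆ E ∪ {q}) (hlq : insert l q ∈ E) : Reach k F Γ (a + b + 3) E := by
  refine hX.weaken₂ hY hXE hYE (isKDnf_union hE (isKDnf_singleton ?_))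
    (isKDnf_union hE (isKDnf_singleton (by omega))) hE ?_
  · rw [card_singleton]
    omega
  · have := ResKInf.andIntro E E l q hq
    rwa [union_self, union_eq_left.2 (singleton_subset_iff.2 hlq)] at this

/-- Terms that can be removed one at a time can be removed together. -/
theorem Reach.elim {ι : Type} [DecidableEq ι] (s : Finset ι) (g : ι → PTerm V)
    (hg : ∀ i ∈ s, (g i).card ≤ k)
    (h : ∀ i ∈ s, ∀ E', E ⊆ E' → IsKDnf k E' → ∀ Γ', E' ∪ {g i} ∈ Γ' → Reach k F Γ' b E')
    (hE : IsKDnf k E) (h₀ : Reach k F Γ a (E ∪ s.image g)) : Reach k F Γ (a + s.card * b) E := by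
  induction s using Finset.induction_on generalizing a with
  | empty => simpa using h₀
  | insert i s hi ih =>
    have hs : IsKDnf k (E ∪ s.image g) :=
      isKDnf_union hE (isKDnf_image fun j hj => hg j (mem_insert_of_mem hj))
    have h₁ : Reach k F Γ (a + b) (E ∪ s.image g) := by
      refine h₀.bind (h i (mem_insert_self i s) _ subset_union_left hs _ (Or.inl ?_))
      rw [image_insert]
      ext q
      simp only [mem_union, mem_insert, mem_singleton]
      tauto
    refine (ih (fun j hj => hg j (mem_insert_of_mem hj))
      (fun j hj => h j (mem_insert_of_mem hj)) h₁).mono_cost ?_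
    rw [card_insert_of_notMem hi, add_mul]
    omega

/-- Case distinction over the values of some variables. -/
theorem Reach.cases_on (hk : 1 ≤ k) {ι : Type} [DecidableEq ι] (s : Finset ι) (v : ι → V)
    (hE : IsKDnf k E)
    (h : ∀ τ : ι → Bool, Reach k F Γ c (E ∪ s.image fun i => ({⟨v i, !τ i⟩} : PTerm V))) :
    ∃ t, t + 3 ≤ 2 ^ s.card * (c + 3) ∧ Reach k F Γ t E := by
  induction s using Finset.induction_on generalizing E with
  | empty => exact ⟨c, by simp, by simpa using h fun _ => false⟩
  | insert i s hi ih =>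
    have key : ∀ b : Bool, ∃ t, t + 3 ≤ 2 ^ s.card * (c + 3) ∧
        Reach k F Γ t (E ∪ {({⟨v i, !b⟩} : PTerm V)}) := by
      intro b
      refine ih (isKDnf_union hE (isKDnf_singleton (by simpa using hk))) fun τ => ?_
      have := h (Function.update τ i b)
      rw [image_insert, Function.update_self] at this
      have hs : (s.image fun j => ({⟨v j, !Function.update τ i b j⟩} : PTerm V)) =
          s.image fun j => ({⟨v j, !τ j⟩} : PTerm V) := by
        refine image_congr fun j hj => ?_
        have : j ≠ i := fun h => hi (h ▸ hj)
        simp [Function.update_of_ne this]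
      rw [hs] at this
      rwa [union_assoc, singleton_union]
    obtain ⟨t₁, ht₁, h₁⟩ := key false
    obtain ⟨t₂, ht₂, h₂⟩ := key true
    refine ⟨t₁ + t₂ + 3, ?_, Reach.cut hk hE (q := {⟨v i, true⟩}) (by simpa using hk)
      h₁ (by simp) h₂ (by simp [Lit.neg])⟩
    rw [card_insert_of_notMem hi, pow_succ]
    linarith

end Derivations

end ResKWeak

namespace ResKWeak

section UpperBound

variable {k n r : ℕ} {U : Type} [DecidableEq U]

theorem clauseToDnf_union (C D : Clause V) : clauseToDnf (C ∪ D) = clauseToDnf C ∪ clauseToDnf D :=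
  image_union _ _

theorem mapClause_union {V' : Type} [DecidableEq V'] (f : V → V') (C D : Clause V) :
    mapClause f (C ∪ D) = mapClause f C ∪ mapClause f D :=
  image_union _ _

def selDnf (w : Node n r) (σ : Fin k → Bool) : Dnf (U ⊕ RefVar k n r U) :=
  univ.image fun i => {⟨Sum.inr (w, Sum.inl i), !σ i⟩}

def ptrDnf (w : Node n r) (σ : Fin k → Bool) (b : Bool) (u : Fin r → Bool) :
    Dnf (U ⊕ RefVar k n r U) :=
  univ.image fun i => {⟨Sum.inr (w, Sum.inr (σ, Sum.inr (b, i))), !u i⟩}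

theorem clauseToDnf_selNe (w : Node n r) (σ : Fin k → Bool) :
    clauseToDnf (mapClause Sum.inr (selNe w σ : Clause (RefVar k n r U))) =
      (selDnf w σ : Dnf (U ⊕ RefVar k n r U)) := by
  simp only [clauseToDnf, mapClause, selNe, selDnf, image_image]
  rfl

theorem clauseToDnf_ptrNe (w : Node n r) (σ : Fin k → Bool) (b : Bool) (u : Fin r → Bool) :
    clauseToDnf (mapClause Sum.inr (ptrNe w σ b u : Clause (RefVar k n r U))) =
      (ptrDnf w σ b u : Dnf (U ⊕ RefVar k n r U)) := by
  simp only [clauseToDnf, mapClause, ptrNe, ptrDnf, image_image]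
  rfl

def nodeLit (w : Node n r) (σ : Fin k → Bool) (l : Lit U) (s : Bool) :
    Lit (U ⊕ RefVar k n r U) :=
  ⟨Sum.inr (w, Sum.inr (σ, Sum.inl l)), s⟩

def baseLit (k n r : ℕ) (l : Lit U) : Lit (U ⊕ RefVar k n r U) := ⟨Sum.inl l.var, l.pos⟩

/-- The term stating that `l` is a true literal of the clause of the copy `σ` of `w`. -/
def litTerm (w : Node n r) (σ : Fin k → Bool) (l : Lit U) : PTerm (U ⊕ RefVar k n r U) :=
  {nodeLit w σ l true, baseLit k n r l}

theorem clauseToDnf_stepClause (d : Fin n) (i : Fin r → Bool) (σ : Fin k → Bool) (b : Bool)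
    (u : Fin r → Bool) (τ : Fin k → Bool) (l : Lit U) :
    clauseToDnf (mapClause Sum.inr (stepClause d i σ b u τ l)) =
      selDnf (d.castSucc, i) σ ∪ ptrDnf (d.castSucc, i) σ b u ∪ selDnf (d.succ, u) τ ∪
        {{nodeLit (d.succ, u) τ l false}, {nodeLit (d.castSucc, i) σ l true}} := by
  rw [stepClause]
  simp only [mapClause_union, clauseToDnf_union, clauseToDnf_selNe, clauseToDnf_ptrNe]
  congr 1
  simp [mapClause, clauseToDnf, mapLit, inClause, nodeLit]

theorem clauseToDnf_leafClause (i : Fin r → Bool) (σ : Fin k → Bool)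
    (u : Fin r → Bool) (l : Lit U) :
    clauseToDnf (mapClause Sum.inr (leafClause (n := n) i σ u l)) =
      selDnf (Fin.last n, i) σ ∪ ptrDnf (Fin.last n, i) σ false u ∪
        {{nodeLit (Fin.last n, i) σ l true}} := by
  rw [leafClause]
  simp only [mapClause_union, clauseToDnf_union, clauseToDnf_selNe, clauseToDnf_ptrNe]
  congr 1

theorem clauseToDnf_rootClause (σ : Fin k → Bool) (l : Lit U) :
    clauseToDnf (mapClause Sum.inr (rootClause (n := n) (r := r) σ l)) =
      selDnf root σ ∪ {{nodeLit root σ l false}} := by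
  rw [rootClause]
  simp only [mapClause_union, clauseToDnf_union, clauseToDnf_selNe]
  congr 1

variable [Fintype U]

/-- The line stating that the clause of the copy `σ` of `w` is true if this copy is selected. -/
def nodeLine (w : Node n r) (σ : Fin k → Bool) : Dnf (U ⊕ RefVar k n r U) :=
  selDnf w σ ∪ univ.image (litTerm w σ)

theorem card_litTerm_le (hk : 2 ≤ k) (w : Node n r) (σ : Fin k → Bool) (l : Lit U) :
    (litTerm w σ l).card ≤ k :=
  card_le_two.trans hk

theorem isKDnf_selDnf (hk : 2 ≤ k) (w : Node n r) (σ : Fin k → Bool) :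
    IsKDnf k (selDnf w σ : Dnf (U ⊕ RefVar k n r U)) :=
  isKDnf_image fun i _ => by
    rw [card_singleton]
    omega

theorem isKDnf_ptrDnf (hk : 2 ≤ k) (w : Node n r) (σ : Fin k → Bool) (b : Bool)
    (u : Fin r → Bool) : IsKDnf k (ptrDnf w σ b u : Dnf (U ⊕ RefVar k n r U)) :=
  isKDnf_image fun i _ => by
    rw [card_singleton]
    omega

theorem isKDnf_nodeLine (hk : 2 ≤ k) (w : Node n r) (σ : Fin k → Bool) :
    IsKDnf k (nodeLine w σ : Dnf (U ⊕ RefVar k n r U)) :=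
  isKDnf_union (isKDnf_selDnf hk w σ) (isKDnf_image fun l _ => card_litTerm_le hk w σ l)

variable {ord : Fin n → U} {cl : (Fin r → Bool) → Clause U}
  {F : Set (Clause (U ⊕ RefVar k n r U))} {Γ : Set (Dnf (U ⊕ RefVar k n r U))}

theorem reach_nodeLine_step (hk : 2 ≤ k)
    (hF : ∀ C ∈ reflection k ord cl, mapClause Sum.inr C ∈ F) (d : Fin n) (i : Fin r → Bool)
    (σ : Fin k → Bool) (hΓ : ∀ u τ, nodeLine (d.succ, u) τ ∈ Γ) :
    Reach k F Γ (2 * (2 ^ r * (2 ^ k * (8 * Fintype.card (Lit U) + 4) + 3)))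
      (nodeLine (d.castSucc, i) σ) := by
  have hk₁ : 1 ≤ k := by omega
  set E := (nodeLine (d.castSucc, i) σ : Dnf (U ⊕ RefVar k n r U)) with hE
  have hEk : IsKDnf k E := isKDnf_nodeLine hk _ _
  have branch : ∀ b : Bool, ∃ t, t + 3 ≤ 2 ^ r * (2 ^ k * (8 * Fintype.card (Lit U) + 4) + 3) ∧
      Reach k F Γ t (E ∪ {{baseLit k n r ⟨ord d, !b⟩}}) := by
    intro b
    set E₁ := E ∪ {{baseLit k n r ⟨ord d, !b⟩}} with hE₁
    have hE₁k : IsKDnf k E₁ := isKDnf_union hEk (isKDnf_singleton (by rwa [card_singleton]))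
    have hu : ∀ u : Fin r → Bool, Reach k F Γ (2 ^ k * (8 * Fintype.card (Lit U) + 4))
        (E₁ ∪ ptrDnf (d.castSucc, i) σ b u) := by
      intro u
      set E₂ := E₁ ∪ ptrDnf (d.castSucc, i) σ b u with hE₂
      have hE₂k : IsKDnf k E₂ := isKDnf_union hE₁k (isKDnf_ptrDnf hk _ _ _ _)
      have hτ : ∀ τ : Fin k → Bool, Reach k F Γ (8 * Fintype.card (Lit U) + 1)
          (E₂ ∪ selDnf (d.succ, u) τ) := by
        intro τ
        set E₃ := E₂ ∪ selDnf (d.succ, u) τ with hE₃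
        have hE₃k : IsKDnf k E₃ := isKDnf_union hE₂k (isKDnf_selDnf hk _ _)
        have hstart : Reach k F Γ 1 (E₃ ∪ univ.image (litTerm (d.succ, u) τ)) := by
          refine (Reach.hyp (hΓ u τ)).weaken ?_
            (isKDnf_union hE₃k (isKDnf_image fun l _ => card_litTerm_le hk _ _ l))
          exact union_subset_union_left subset_union_right
        refine (hstart.elim univ _ (fun l _ => card_litTerm_le hk _ _ l) (b := 8) ?_
          hE₃k).mono_cost (by rw [card_univ]; omega)
        intro l _ E' hE' hE'k Γ' hΓ'
        by_cases hl : l = ⟨ord d, !b⟩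
        · refine (Reach.cut hk₁ hE'k (card_litTerm_le hk _ _ l) (Reach.hyp hΓ') subset_rfl
            (Reach.ax hk₁ (baseLit k n r l)) ?_).mono_cost (by norm_num)
          have : ({baseLit k n r l} : PTerm (U ⊕ RefVar k n r U)) ∈ E' :=
            hE' (by simp [hE₃, hE₂, hE₁, hl])
          intro q hq
          simp only [mem_insert, mem_singleton] at hq
          rcases hq with rfl | rfl
          · exact mem_union_left _ this
          · simp [litTerm]
        · set E'' := E' ∪ (litTerm (d.succ, u) τ l).image
            fun l => ({l.neg} : PTerm (U ⊕ RefVar k n r U)) with hE''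
          have hE''k : IsKDnf k E'' :=
            isKDnf_union hE'k (isKDnf_image fun l _ => by rwa [card_singleton])
          have hC : Reach k F Γ' 1 _ := Reach.clause hk₁
            (hF _ (mem_reflection.2 (Or.inl ⟨d, i, σ, b, u, τ, l, hl, rfl⟩)))
          rw [clauseToDnf_stepClause] at hC
          have hpair : Reach k F Γ' 5 E'' := by
            refine hC.andIntro hE''k (l := nodeLit (d.castSucc, i) σ l true)
              (q := {baseLit k n r l}) (by rwa [card_singleton]) ?_
              (Reach.ax hk₁ (baseLit k n r l)) ?_ ?_
            · intro q hq
              simp only [mem_union, mem_insert, mem_singleton] at hq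
              rcases hq with ((hq | hq) | hq) | rfl | rfl
              · refine mem_union_left _ (mem_union_left _ (hE' ?_))
                simp only [hE₃, hE₂, hE₁, hE, nodeLine, mem_union, hq, true_or]
              · refine mem_union_left _ (mem_union_left _ (hE' ?_))
                simp only [hE₃, hE₂, mem_union, hq, or_true, true_or]
              · refine mem_union_left _ (mem_union_left _ (hE' ?_))
                simp only [hE₃, mem_union, hq, or_true]
              · simp [hE'', litTerm, nodeLit, Lit.neg]
              · simp
            · intro q hq
              simp only [mem_insert, mem_singleton] at hq
              rcases hq with rfl | rfl
              · simp
              · simp [hE'', litTerm]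
            · refine mem_union_left _ (hE' ?_)
              simp only [hE₃, hE₂, hE₁, hE, nodeLine, mem_union]
              exact Or.inl (Or.inl (Or.inl (Or.inr (mem_image_of_mem _ (mem_univ l)))))
          exact (Reach.cut hk₁ hE'k (card_litTerm_le hk _ _ l) (Reach.hyp hΓ') subset_rfl
            hpair subset_rfl).mono_cost (by norm_num)
      obtain ⟨t, ht, h⟩ := Reach.cases_on hk₁ univ
        (fun i => Sum.inr ((d.succ, u), Sum.inl i)) hE₂k hτ
      refine h.mono_cost ?_
      rw [card_univ, Fintype.card_fin] at ht
      linarith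
    obtain ⟨t, ht, h⟩ := Reach.cases_on hk₁ univ
      (fun j => Sum.inr ((d.castSucc, i), Sum.inr (σ, Sum.inr (b, j)))) hE₁k hu
    rw [card_univ, Fintype.card_fin] at ht
    exact ⟨t, ht, h⟩
  obtain ⟨t₁, ht₁, h₁⟩ := branch false
  obtain ⟨t₂, ht₂, h₂⟩ := branch true
  refine (Reach.cut hk₁ hEk (q := {baseLit k n r ⟨ord d, true⟩}) (by rwa [card_singleton])
    h₁ subset_rfl h₂ ?_).mono_cost (by omega)
  simp [baseLit, Lit.neg]

theorem reach_nodeLine_leaf (hk : 2 ≤ k)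
    (hF : ∀ C ∈ reflection k ord cl, mapClause Sum.inr C ∈ F)
    (hcl : ∀ u, mapClause Sum.inl (cl u) ∈ F) (i : Fin r → Bool) (σ : Fin k → Bool) :
    Reach k F Γ (2 ^ r * (4 * Fintype.card (Lit U) + 5)) (nodeLine (Fin.last n, i) σ) := by
  have hk₁ : 1 ≤ k := by omega
  set E := (nodeLine (Fin.last n, i) σ : Dnf (U ⊕ RefVar k n r U)) with hE
  have hEk : IsKDnf k E := isKDnf_nodeLine hk _ _
  have hu : ∀ u : Fin r → Bool, Reach k F Γ (4 * Fintype.card (Lit U) + 2)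
      (E ∪ ptrDnf (Fin.last n, i) σ false u) := by
    intro u
    set E₁ := E ∪ ptrDnf (Fin.last n, i) σ false u with hE₁
    have hE₁k : IsKDnf k E₁ := isKDnf_union hEk (isKDnf_ptrDnf hk _ _ _ _)
    have hcard : ∀ l ∈ cl u, ({baseLit k n r l} : PTerm (U ⊕ RefVar k n r U)).card ≤ k := by
      intro l _
      rwa [card_singleton]
    have hstart : Reach k F Γ 2
        (E₁ ∪ (cl u).image fun l => ({baseLit k n r l} : PTerm (U ⊕ RefVar k n r U))) := by
      refine (Reach.clause hk₁ (hcl u)).weaken ?_ (isKDnf_union hE₁k (isKDnf_image hcard))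
      simp only [clauseToDnf, mapClause, image_image]
      exact subset_union_right
    refine (hstart.elim (cl u) _ hcard (b := 4) ?_ hE₁k).mono_cost ?_
    · intro l hl E' hE' hE'k Γ' hΓ'
      have hC : Reach k F Γ' 1 _ := Reach.clause hk₁
        (hF _ (mem_reflection.2 (Or.inr (Or.inl ⟨i, σ, u, l, hl, rfl⟩))))
      rw [clauseToDnf_leafClause] at hC
      refine hC.andIntro hE'k (l := nodeLit (Fin.last n, i) σ l true)
        (q := {baseLit k n r l}) (by rwa [card_singleton]) ?_ (Reach.hyp hΓ') subset_rfl ?_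
      · refine union_subset_union_left (union_subset ?_ ?_)
        · exact (subset_union_left.trans subset_union_left).trans hE'
        · exact subset_union_right.trans hE'
      · refine hE' ?_
        simp only [hE₁, hE, nodeLine, mem_union]
        exact Or.inl (Or.inr (mem_image_of_mem _ (mem_univ l)))
    · have := card_le_univ (cl u)
      omega
  obtain ⟨t, ht, h⟩ := Reach.cases_on hk₁ univ
    (fun j => Sum.inr ((Fin.last n, i), Sum.inr (σ, Sum.inr (false, j)))) hEk hu
  refine h.mono_cost ?_
  rw [card_univ, Fintype.card_fin] at ht
  linarith

theorem reach_empty_root (hk : 2 ≤ k)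
    (hF : ∀ C ∈ reflection k ord cl, mapClause Sum.inr C ∈ F)
    (hΓ : ∀ σ, nodeLine root σ ∈ Γ) :
    Reach k F Γ (2 ^ k * (4 * Fintype.card (Lit U) + 3)) ∅ := by
  have hk₁ : 1 ≤ k := by omega
  have hσ : ∀ σ : Fin k → Bool, Reach k F Γ (4 * Fintype.card (Lit U)) (∅ ∪ selDnf root σ) := by
    intro σ
    rw [empty_union]
    refine ((Reach.hyp (hΓ σ)).elim univ (litTerm root σ) (fun l _ => card_litTerm_le hk _ _ l)
      (b := 4) ?_ (isKDnf_selDnf hk _ _)).mono_cost (by rw [card_univ]; omega)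
    intro l _ E' hE' hE'k Γ' hΓ'
    have hC : Reach k F Γ' 1 _ := Reach.clause hk₁
      (hF _ (mem_reflection.2 (Or.inr (Or.inr ⟨σ, l, rfl⟩))))
    rw [clauseToDnf_rootClause] at hC
    refine Reach.cut hk₁ hE'k (card_litTerm_le hk _ _ l) (Reach.hyp hΓ') subset_rfl hC ?_
    refine union_subset_union hE' ?_
    simp [litTerm, nodeLit, Lit.neg]
  obtain ⟨t, ht, h⟩ := Reach.cases_on hk₁ univ
    (fun i => Sum.inr (root, Sum.inl i)) (by simp [IsKDnf]) hσ
  refine h.mono_cost ?_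
  rw [card_univ, Fintype.card_fin] at ht
  omega

/-- The length of the short refutation of a CNF together with its reflection formula. -/
def refutationBound (k n r m : ℕ) : ℕ :=
  2 ^ r * 2 ^ k * (2 ^ r * (4 * m + 5)) +
    (n * (2 ^ r * 2 ^ k * (2 * (2 ^ r * (2 ^ k * (8 * m + 4) + 3)))) +
      2 ^ k * (4 * m + 3)) + 1

theorem exists_short_refutation (hk : 2 ≤ k)
    (hF : ∀ C ∈ reflection k ord cl, mapClause Sum.inr C ∈ F)
    (hcl : ∀ u, mapClause Sum.inl (cl u) ∈ F) :
    ∃ P, IsResKRefutation k F P ∧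
      P.length ≤ refutationBound k n r (Fintype.card (Lit U)) := by
  set m := Fintype.card (Lit U)
  set cStep := 2 ^ r * 2 ^ k * (2 * (2 ^ r * (2 ^ k * (8 * m + 4) + 3))) with hcStep
  let Γ : Fin (n + 1) → Set (Dnf (U ⊕ RefVar k n r U)) := fun t =>
    {G | ∃ x ∈ (univ : Finset ((Fin r → Bool) × (Fin k → Bool))), nodeLine (t, x.1) x.2 = G}
  have hmem : ∀ t i σ, nodeLine (t, i) σ ∈ Γ t := fun t i σ => ⟨(i, σ), mem_univ _, rfl⟩
  have hcard : (univ : Finset ((Fin r → Bool) × (Fin k → Bool))).card = 2 ^ r * 2 ^ k := by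
    simp
  have hlevel : ∀ t : Fin (n + 1), Reach k F (Γ t) (t * cStep + 2 ^ k * (4 * m + 3)) ∅ := by
    intro t
    induction t using Fin.induction with
    | zero =>
      exact (reach_empty_root hk hF fun σ => hmem 0 (fun _ => false) σ).mono_cost (by simp [m])
    | succ d ih =>
      refine (Reach.bind_family univ
        (fun x : (Fin r → Bool) × (Fin k → Bool) => nodeLine (d.castSucc, x.1) x.2)
        (fun x _ => reach_nodeLine_step hk hF d x.1 x.2 fun u τ => hmem d.succ u τ)
        (ih.mono Set.subset_union_right)).mono_cost ?_
      rw [hcard, Fin.val_succ, Fin.val_castSucc, add_mul, one_mul, ← hcStep]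
      omega
  have hfinal : Reach k F ∅ (refutationBound k n r m - 1) ∅ := by
    refine (Reach.bind_family univ
      (fun x : (Fin r → Bool) × (Fin k → Bool) => nodeLine (Fin.last n, x.1) x.2)
      (fun x _ => reach_nodeLine_leaf hk hF hcl x.1 x.2)
      ((hlevel (Fin.last n)).mono Set.subset_union_right)).mono_cost ?_
    rw [hcard, refutationBound, Fin.val_last, ← hcStep]
    exact le_of_eq (Nat.add_sub_cancel ..).symm
  obtain ⟨L, hL, hc, hmem⟩ := hfinal [] Deriv.nil (by simp)
  obtain ⟨P, hP, hlen⟩ := hL.exists_refutation hmem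
  refine ⟨P, hP, ?_⟩
  rw [hlen, List.nil_append]
  have : 1 ≤ refutationBound k n r m := by
    rw [refutationBound]
    omega
  omega

end UpperBound

end ResKWeak

namespace ResKWeak

section Pair

theorem exists_enumeration {α : Type} {s : Finset α} (hs : s.Nonempty) {r : ℕ}
    (hr : s.card ≤ 2 ^ r) :
    ∃ f : (Fin r → Bool) → α, (∀ u, f u ∈ s) ∧ ∀ c ∈ s, ∃ u, f u = c := by
  have : Nonempty s := hs.to_subtype
  obtain ⟨f⟩ : Nonempty (s ↪ (Fin r → Bool)) :=
    Function.Embedding.nonempty_of_card_le (by simpa using hr)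
  refine ⟨fun u => (Function.invFun f u).1, fun u => (Function.invFun f u).2, fun c hc => ?_⟩
  exact ⟨f ⟨c, hc⟩, congrArg Subtype.val (Function.leftInverse_invFun f.injective ⟨c, hc⟩)⟩

theorem mem_cnfVars {F : Cnf V} {x : V} : x ∈ cnfVars F ↔ ∃ C ∈ F, ∃ l ∈ C, l.var = x := by
  simp [cnfVars, Finset.mem_sup]

/-- A refutation lower bound is preserved under injective renaming of variables. -/
theorem le_length_of_injective {U : Type} [DecidableEq U] [Nonempty U] {k e : ℕ} {f : U → V}
    (hf : Function.Injective f) {A : Cnf U}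
    (hA : ∀ P, IsResKRefutation k (↑A : Set (Clause U)) P → 2 ^ e ≤ P.length)
    {P : List (Dnf V)}
    (hP : IsResKRefutation k (↑(A.image (mapClause f)) : Set (Clause V)) P) :
    2 ^ e ≤ P.length := by
  have := hA _ (isResKRefutation_map (F' := (↑A : Set (Clause U))) (Function.invFun f) ?_ hP)
  · simpa using this
  · intro C hC
    obtain ⟨D, hD, rfl⟩ := mem_image.1 (mem_coe.1 hC)
    rw [mapClause_mapClause, Function.invFun_comp hf, mapClause_id]
    exact hD

theorem disjoint_cnfVars_image {U U' : Type} [DecidableEq U] [DecidableEq U'] {f : U → V}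
    {f' : U' → V} (h : ∀ x y, f x ≠ f' y) (A : Cnf U) (B : Cnf U') :
    Disjoint (cnfVars (A.image (mapClause f))) (cnfVars (B.image (mapClause f'))) := by
  refine Finset.disjoint_left.2 fun x hx hx' => ?_
  obtain ⟨C, hC, l, hl, rfl⟩ := mem_cnfVars.1 hx
  obtain ⟨D, hD, m, hm, hlm⟩ := mem_cnfVars.1 hx'
  obtain ⟨C, -, rfl⟩ := mem_image.1 hC
  obtain ⟨D, -, rfl⟩ := mem_image.1 hD
  obtain ⟨l, -, rfl⟩ := mem_image.1 hl
  obtain ⟨m, -, rfl⟩ := mem_image.1 hm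
  exact h l.var m.var hlm.symm

/-- A hard CNF and its reflection formula are two hard CNFs in disjoint variables, whose conjunction
has a short refutation. -/
theorem exists_hard_pair {U : Type} [Fintype U] [DecidableEq U] [Nonempty U] {k r e : ℕ}
    (hk : 2 ≤ k) {A : Cnf U} (hA : ∀ x : U → Bool, ∃ C ∈ A, ¬ SatClauseA x C)
    (hlow : ∀ P, IsResKRefutation k (↑A : Set (Clause U)) P → 2 ^ e ≤ P.length)
    (hcard : A.card ≤ 2 ^ r)
    (hr : 3 * (3 * queryBound k (k + 2 ^ k * (Fintype.card U * 2 + 2 * r)) k e) + 2 ≤ 2 ^ r) :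
    ∃ A' B' : Cnf ℕ, Disjoint (cnfVars A') (cnfVars B') ∧
      (∃ P, IsResKRefutation k (↑(A' ∪ B') : Set (Clause ℕ)) P ∧
        P.length ≤ refutationBound k (Fintype.card U) r (Fintype.card U * 2)) ∧
      (∀ P, IsResKRefutation k (↑A' : Set (Clause ℕ)) P → 2 ^ e ≤ P.length) ∧
      ∀ P, IsResKRefutation k (↑B' : Set (Clause ℕ)) P → 2 ^ e ≤ P.length := by
  obtain ⟨C₀, hC₀, -⟩ := hA fun _ => false
  obtain ⟨cl, hcl, hcl'⟩ := exists_enumeration ⟨C₀, hC₀⟩ hcard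
  let ord := (Fintype.equivFin U).symm
  let B := reflection k ord cl
  have hBlow : ∀ P, IsResKRefutation k (↑B : Set (Clause (RefVar k (Fintype.card U) r U))) P →
      2 ^ e ≤ P.length := by
    refine fun P hP => reflection_le_length ord.surjective (fun x => ?_) hr hP
    obtain ⟨C, hC, hx⟩ := hA x
    obtain ⟨u, rfl⟩ := hcl' C hC
    exact ⟨u, fun l hl h => hx ⟨l, hl, h⟩⟩
  let enc : U ⊕ RefVar k (Fintype.card U) r U → ℕ := fun x => (Fintype.equivFin _ x : ℕ)
  have henc : Function.Injective enc := Fin.val_injective.comp (Equiv.injective _)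
  have : Nonempty (RefVar k (Fintype.card U) r U) :=
    ⟨(root, Sum.inl ⟨0, by omega⟩)⟩
  refine ⟨A.image (mapClause (enc ∘ Sum.inl)), B.image (mapClause (enc ∘ Sum.inr)),
    disjoint_cnfVars_image (fun x y h => Sum.inl_ne_inr (henc h)) A B, ?_,
    fun P => le_length_of_injective (henc.comp Sum.inl_injective) hlow,
    fun P => le_length_of_injective (henc.comp Sum.inr_injective) hBlow⟩
  obtain ⟨P, hP, hlen⟩ := exists_short_refutation
    (F := (↑(A.image (mapClause Sum.inl) ∪ B.image (mapClause Sum.inr)) :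
      Set (Clause (U ⊕ RefVar k (Fintype.card U) r U)))) hk
    (fun C hC => mem_coe.2 (mem_union_right _ (mem_image_of_mem _ hC)))
    fun u => mem_coe.2 (mem_union_left _ (mem_image_of_mem _ (hcl u)))
  refine ⟨P.map (mapDnf enc), isResKRefutation_map enc (fun C hC => ?_) hP, ?_⟩
  · rw [mem_coe, mem_union] at hC ⊢
    rcases hC with hC | hC
    · obtain ⟨D, hD, rfl⟩ := mem_image.1 hC
      rw [mapClause_mapClause]
      exact Or.inl (mem_image_of_mem _ hD)
    · obtain ⟨D, hD, rfl⟩ := mem_image.1 hC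
      rw [mapClause_mapClause]
      exact Or.inr (mem_image_of_mem _ hD)
  · rw [List.length_map]
    rwa [card_lit] at hlen

/-- The number of variables of the reflection formula of the base clauses. -/
def baseSize (k n r : ℕ) : ℕ :=
  (n + n + 1) * 2 ^ r * (k + 2 ^ k * ((n + n) * 2 + 2 * r))

theorem exists_base_pair {k n r s : ℕ} (hk : 2 ≤ k) (hrn : r < n) (hnr : n * 2 + 1 ≤ 2 ^ r)
    (hr : 3 * (3 * queryBound k (k + 2 ^ k * ((n + n) * 2 + 2 * r)) k n) + 2 ≤ 2 ^ r)
    (hcard : (n + n) * 2 * ((n + n) * 2) * (2 ^ r * 2 ^ r * (2 ^ k * 2 ^ k)) +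
      2 ^ r * (2 ^ k * 2 ^ r) * ((n + n) * 2) + 2 ^ k * ((n + n) * 2) ≤ 2 ^ s)
    (hs : 3 * (3 * queryBound k (k + 2 ^ k * (baseSize k n r * 2 + 2 * s)) k n) + 2 ≤ 2 ^ s) :
    ∃ A B : Cnf ℕ, Disjoint (cnfVars A) (cnfVars B) ∧
      (∃ P, IsResKRefutation k (↑(A ∪ B) : Set (Clause ℕ)) P ∧
        P.length ≤ refutationBound k (baseSize k n r) s (baseSize k n r * 2)) ∧
      (∀ P, IsResKRefutation k (↑A : Set (Clause ℕ)) P → 2 ^ n ≤ P.length) ∧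
      ∀ P, IsResKRefutation k (↑B : Set (Clause ℕ)) P → 2 ^ n ≤ P.length := by
  obtain ⟨g, -, hg⟩ := exists_enumeration (α := (Fin n × Bool) ⊕ Unit) (s := univ) (r := r)
    ⟨Sum.inr (), mem_univ _⟩ (by simpa using hnr)
  have hU : Fintype.card (Fin n ⊕ Fin n) = n + n := by simp
  have hsize : Fintype.card (RefVar k (n + n) r (Fin n ⊕ Fin n)) = baseSize k n r := by
    rw [card_relVar, card_node, card_nodeData, hU, baseSize]
  have : Nonempty (RefVar k (n + n) r (Fin n ⊕ Fin n)) := ⟨(root, Sum.inl ⟨0, by omega⟩)⟩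
  rw [← hsize] at hs ⊢
  refine exists_hard_pair hk (reflection_base_unsat (k := k) hrn g)
    (fun P hP => reflection_le_length (Equiv.surjective _) (fun x => ?_) (by rwa [hU]) hP)
    (card_reflection_le.trans (by rwa [hU])) hs
  obtain ⟨c, hc⟩ := exists_baseClause_falsified x
  obtain ⟨u, rfl⟩ := hg c (mem_univ _)
  exact ⟨u, hc⟩

end Pair

end ResKWeak

namespace ResKWeak

section Growth

def PolyBounded (f : ℕ → ℕ) : Prop := ∃ c, ∀ n, f n ≤ (n + 2) ^ c

variable {f g : ℕ → ℕ}

theorem PolyBounded.mono (hg : PolyBounded g) (h : ∀ n, f n ≤ g n) : PolyBounded f := by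
  obtain ⟨c, hc⟩ := hg
  exact ⟨c, fun n => (h n).trans (hc n)⟩

theorem PolyBounded.const (a : ℕ) : PolyBounded fun _ => a :=
  ⟨a, fun n => Nat.lt_two_pow_self.le.trans (Nat.pow_le_pow_left (by omega) a)⟩

theorem PolyBounded.id : PolyBounded fun n => n := ⟨1, fun n => by simp⟩

theorem PolyBounded.mul (hf : PolyBounded f) (hg : PolyBounded g) :
    PolyBounded fun n => f n * g n := by
  obtain ⟨c, hc⟩ := hf
  obtain ⟨d, hd⟩ := hg
  exact ⟨c + d, fun n => by rw [pow_add]; exact Nat.mul_le_mul (hc n) (hd n)⟩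

theorem PolyBounded.add (hf : PolyBounded f) (hg : PolyBounded g) :
    PolyBounded fun n => f n + g n := by
  obtain ⟨c, hc⟩ := hf
  obtain ⟨d, hd⟩ := hg
  refine ⟨c + d + 1, fun n => ?_⟩
  have h₁ := (hc n).trans (Nat.pow_le_pow_right (n := n + 2) (by omega) (Nat.le_add_right c d))
  have h₂ := (hd n).trans (Nat.pow_le_pow_right (n := n + 2) (by omega) (Nat.le_add_left d c))
  rw [pow_succ]
  nlinarith

theorem PolyBounded.pow (hf : PolyBounded f) (a : ℕ) : PolyBounded fun n => f n ^ a := by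
  obtain ⟨c, hc⟩ := hf
  exact ⟨c * a, fun n => by rw [pow_mul]; exact Nat.pow_le_pow_left (hc n) a⟩

theorem PolyBounded.two_pow_clog (hf : PolyBounded f) :
    PolyBounded fun n => 2 ^ Nat.clog 2 (f n) := by
  refine ((PolyBounded.const 2).mul (hf.add (.const 1))).mono fun n => ?_
  rcases Nat.lt_or_ge 1 (f n) with h | h
  · have h₁ := Nat.pow_pred_clog_lt_self one_lt_two h
    have h₂ : Nat.clog 2 (f n) = (Nat.clog 2 (f n)).pred + 1 :=
      (Nat.succ_pred_eq_of_pos (Nat.clog_pos one_lt_two h)).symm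
    rw [h₂, pow_succ]
    omega
  · rw [Nat.clog_of_right_le_one h]
    omega

theorem PolyBounded.clog (hf : PolyBounded f) : PolyBounded fun n => Nat.clog 2 (f n) :=
  hf.two_pow_clog.mono fun _ => Nat.lt_two_pow_self.le

theorem polyBounded_eval (p : Polynomial ℕ) : PolyBounded fun n => p.eval n := by
  induction p using Polynomial.induction_on' with
  | add p q hp hq => simpa using hp.add hq
  | monomial m a => simpa using (PolyBounded.const a).mul (PolyBounded.id.pow m)

theorem PolyBounded.eventually_lt_two_pow (hf : PolyBounded f) :
    ∀ᶠ n in Filter.atTop, f n < 2 ^ n := by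
  obtain ⟨c, hc⟩ := hf
  have h := (tendsto_pow_const_div_const_pow_of_one_lt c (one_lt_two (α := ℝ))).comp
    (Filter.tendsto_add_atTop_nat 2)
  filter_upwards [h.eventually_lt_const (show (0 : ℝ) < 1 / 4 by norm_num)] with n hn
  refine (hc n).trans_lt ?_
  simp only [Function.comp_apply] at hn
  rw [div_lt_iff₀ (by positivity), pow_add] at hn
  have : (((n + 2 : ℕ) : ℝ)) ^ c < 2 ^ n := by linarith
  exact_mod_cast this

theorem PolyBounded.eventually_clog_lt (hf : PolyBounded f) :
    ∀ᶠ n in Filter.atTop, Nat.clog 2 (f n) < n := by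
  filter_upwards [hf.two_pow_clog.eventually_lt_two_pow] with n hn
  exact (Nat.pow_lt_pow_iff_right one_lt_two).1 hn

theorem queryBound_le (k v j e : ℕ) :
    queryBound k v j e ≤ e * (1 + k * 2 ^ (k * k + k) * (v + 1)) ^ j := by
  induction j generalizing e with
  | zero => simp [queryBound]
  | succ j ih =>
    rw [queryBound, pow_succ]
    have h₁ := ih (e + k * (2 ^ (k * k + k) * e) * v)
    have h₂ := Nat.one_le_pow j (1 + k * 2 ^ (k * k + k) * (v + 1)) (by omega)
    set X := (1 + k * 2 ^ (k * k + k) * (v + 1)) ^ j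
    calc k * (2 ^ (k * k + k) * e) + queryBound k v j (e + k * (2 ^ (k * k + k) * e) * v)
        ≤ k * (2 ^ (k * k + k) * e) * X + (e + k * (2 ^ (k * k + k) * e) * v) * X :=
          Nat.add_le_add (Nat.le_mul_of_pos_right _ h₂) h₁
      _ = e * (X * (1 + k * 2 ^ (k * k + k) * (v + 1))) := by ring

/-- A closed form for the width parameter required by the lower bound. -/
def widthBound (k m s e : ℕ) : ℕ :=
  9 * (e * (1 + k * 2 ^ (k * k + k) * (k + 2 ^ k * (m * 2 + 2 * s) + 1)) ^ k) + 2

theorem queryBound_le_widthBound {k m s r e : ℕ} (h : r ≤ s) :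
    3 * (3 * queryBound k (k + 2 ^ k * (m * 2 + 2 * r)) k e) + 2 ≤ widthBound k m s e := by
  have h₁ := queryBound_le k (k + 2 ^ k * (m * 2 + 2 * r)) k e
  have h₂ : e * (1 + k * 2 ^ (k * k + k) * (k + 2 ^ k * (m * 2 + 2 * r) + 1)) ^ k ≤
      e * (1 + k * 2 ^ (k * k + k) * (k + 2 ^ k * (m * 2 + 2 * s) + 1)) ^ k := by gcongr
  rw [widthBound]
  omega

theorem PolyBounded.widthBound (k : ℕ) {s e : ℕ → ℕ} (hf : PolyBounded f) (hs : PolyBounded s)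
    (he : PolyBounded e) : PolyBounded fun n => widthBound k (f n) (s n) (e n) :=
  ((PolyBounded.const 9).mul (he.mul (((PolyBounded.const 1).add ((PolyBounded.const _).mul
    (((PolyBounded.const k).add ((PolyBounded.const (2 ^ k)).mul ((hf.mul (.const 2)).add
      ((PolyBounded.const 2).mul hs)))).add (.const 1)))).pow k))).add (.const 2)

/-- The number of clauses of the reflection formula of the base clauses. -/
def baseCard (k n r : ℕ) : ℕ :=
  (n + n) * 2 * ((n + n) * 2) * (2 ^ r * 2 ^ r * (2 ^ k * 2 ^ k)) +
    2 ^ r * (2 ^ k * 2 ^ r) * ((n + n) * 2) + 2 ^ k * ((n + n) * 2)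

theorem exists_polyBounded_pair {k : ℕ} (hk : 2 ≤ k) :
    ∃ t : ℕ → ℕ, PolyBounded t ∧ ∀ᶠ n in Filter.atTop,
      ∃ A B : Cnf ℕ, Disjoint (cnfVars A) (cnfVars B) ∧
        (∃ P, IsResKRefutation k (↑(A ∪ B) : Set (Clause ℕ)) P ∧ P.length ≤ t n) ∧
        (∀ P, IsResKRefutation k (↑A : Set (Clause ℕ)) P → 2 ^ n ≤ P.length) ∧
        ∀ P, IsResKRefutation k (↑B : Set (Clause ℕ)) P → 2 ^ n ≤ P.length := by
  have hid := PolyBounded.id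
  have hc := PolyBounded.const
  let F : ℕ → ℕ := fun n => n * 2 + 1 + widthBound k (n + n) n n
  have hF : PolyBounded F :=
    ((hid.mul (hc 2)).add (hc 1)).add (.widthBound k (hid.add hid) hid hid)
  let r : ℕ → ℕ := fun n => Nat.clog 2 (F n)
  have hr : PolyBounded r := hF.clog
  have hr' : PolyBounded fun n => 2 ^ r n := hF.two_pow_clog
  have hm : PolyBounded fun n => (n + n) * 2 := (hid.add hid).mul (hc 2)
  have hsize : PolyBounded fun n => baseSize k n (r n) :=
    (((hid.add hid).add (hc 1)).mul hr').mul
      ((hc k).add ((hc (2 ^ k)).mul (hm.add ((hc 2).mul hr))))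
  have hcard : PolyBounded fun n => baseCard k n (r n) :=
    (((hm.mul hm).mul ((hr'.mul hr').mul (hc (2 ^ k * 2 ^ k)))).add
      ((hr'.mul ((hc (2 ^ k)).mul hr')).mul hm)).add ((hc (2 ^ k)).mul hm)
  let G : ℕ → ℕ := fun n => baseCard k n (r n) + widthBound k (baseSize k n (r n)) n n
  have hG : PolyBounded G := hcard.add (.widthBound k hsize hid hid)
  let s : ℕ → ℕ := fun n => Nat.clog 2 (G n)
  have hs : PolyBounded fun n => 2 ^ s n := hG.two_pow_clog
  refine ⟨fun n => refutationBound k (baseSize k n (r n)) (s n) (baseSize k n (r n) * 2), ?_, ?_⟩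
  · have h := hsize.mul (hc 2)
    have hsk := hs.mul (hc (2 ^ k))
    exact ((hsk.mul (hs.mul (((hc 4).mul h).add (hc 5)))).add
      ((hsize.mul (hsk.mul ((hc 2).mul (hs.mul (((hc (2 ^ k)).mul
        (((hc 8).mul h).add (hc 4))).add (hc 3)))))).add
        ((hc (2 ^ k)).mul (((hc 4).mul h).add (hc 3))))).add (hc 1)
  · filter_upwards [hF.eventually_clog_lt, hG.eventually_clog_lt] with n hrn hsn
    have hFr : F n ≤ 2 ^ r n := Nat.le_pow_clog one_lt_two _
    have hGs : G n ≤ 2 ^ s n := Nat.le_pow_clog one_lt_two _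
    exact exists_base_pair hk hrn ((Nat.le_add_right _ _).trans hFr)
      ((queryBound_le_widthBound hrn.le).trans ((Nat.le_add_left _ _).trans hFr))
      ((Nat.le_add_right _ _).trans hGs)
      ((queryBound_le_widthBound hsn.le).trans ((Nat.le_add_left _ _).trans hGs))

theorem no_polynomial_bound {k : ℕ} (hk : 2 ≤ k) (p : Polynomial ℕ) :
    ∃ A B : Cnf ℕ, Disjoint (cnfVars A) (cnfVars B) ∧
      ∃ P, IsResKRefutation k (↑(A ∪ B) : Set (Clause ℕ)) P ∧
        (∀ P', IsResKRefutation k (↑A : Set (Clause ℕ)) P' → p.eval P.length < P'.length) ∧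
        ∀ P', IsResKRefutation k (↑B : Set (Clause ℕ)) P' → p.eval P.length < P'.length := by
  obtain ⟨t, ht, h⟩ := exists_polyBounded_pair hk
  obtain ⟨c, hc⟩ := polyBounded_eval p
  obtain ⟨n, hn, A, B, hAB, ⟨P, hP, hlen⟩, hA, hB⟩ :=
    (((ht.add (.const 2)).pow c).eventually_lt_two_pow.and h).exists
  have hlt : p.eval P.length < 2 ^ n :=
    ((hc _).trans (Nat.pow_le_pow_left (Nat.add_le_add_right hlen 2) c)).trans_lt hn
  exact ⟨A, B, hAB, P, hP, fun P' hP' => hlt.trans_le (hA P' hP'),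
    fun P' hP' => hlt.trans_le (hB P' hP')⟩

end Growth

end ResKWeak

/-- For every integer `k ≥ 2`, Res(k) does not have the weak feasible
disjunction property: there is no polynomial `p` such that whenever CNFs `A` and `B`
share no variables and `A ∧ B` has a Res(k) refutation of length `t`, then `A` or `B`
has a Res(k) refutation of length at most `p t`. -/
theorem resK_no_weak_feasible_disjunction (k : ℕ) (hk : 2 ≤ k) :
    ¬ ∃ p : Polynomial ℕ,
      ∀ A B : Cnf ℕ, Disjoint (cnfVars A) (cnfVars B) →
        ∀ P : List (Dnf ℕ), IsResKRefutation k (↑(A ∪ B) : Set (Clause ℕ)) P →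
          (∃ P' : List (Dnf ℕ),
              IsResKRefutation k (↑A : Set (Clause ℕ)) P' ∧ P'.length ≤ p.eval P.length) ∨
          (∃ P' : List (Dnf ℕ),
              IsResKRefutation k (↑B : Set (Clause ℕ)) P' ∧ P'.length ≤ p.eval P.length) := by
  rintro ⟨p, hp⟩
  obtain ⟨A, B, hAB, P, hP, hA, hB⟩ := ResKWeak.no_polynomial_bound hk p
  rcases hp A B hAB P hP with ⟨P', hP', hlen⟩ | ⟨P', hP', hlen⟩
  · exact hlen.not_gt (hA P' hP')
  · exact hlen.not_gt (hB P' hP')
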